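/- Let λ ≥ 0, q ∈ (1,∞), and let L be the higher-order operator whose leading coefficients A^{αβ}, |α|=|β|=m, are measurable functions of t only and whose lower-order coefficients are zero, satisfying the Legendre–Hadamard ellipticity condition with constant δ and |A^{αβ}| ≤ δ^{−1}. Then for every u ∈ C^∞_loc(ℝ^{d+1}) satisfying u_t + (−1)^m Lu + λu = 0 in Q₄ = (−4^{2m}, 0) × B₄, one has Σ_{|α| ≤ 2m} λ^{1 − |α|/(2m)} sup_{Q₁} ( |D(D^α u)| + |(D^α u)_t| ) ≤ N Σ_{|α| ≤ 2m} λ^{1 − |α|/(2m)} ‖D^α u‖_{L_q(Q₄)}, where N = N(d, m, ℓ, δ, q). -/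

import Mathlib

open MeasureTheory Filter
open scoped ENNReal

noncomputable section

/-- Spatial Euclidean space `ℝ^d`. -/
abbrev Esp (d : ℕ) : Type := EuclideanSpace ℝ (Fin d)

/-- Space-time `ℝ^{d+1} = ℝ_t × ℝ^d_x`. -/
abbrev Pt (d : ℕ) : Type := ℝ × Esp d

section QuasiMetric

variable {Y : Type*}

/-- The ball of a quasi-metric `ρ`. -/
def qball (ρ : Y → Y → ℝ) (x : Y) (r : ℝ) : Set Y := {y | ρ x y < r}

/-- `w` is a Muckenhoupt `A_p` weight with characteristic `≤ C` on the subset `𝒳`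
of a quasi-metric measure space. -/
def ApBoundOn [MeasurableSpace Y] (ρ : Y → Y → ℝ) (μ : Measure Y) (𝒳 : Set Y)
    (p : ℝ) (w : Y → ℝ) (C : ℝ) : Prop :=
  (∀ x, 0 ≤ w x) ∧ Measurable w ∧
    ∀ x ∈ 𝒳, ∀ r : ℝ, 0 < r →
      ((∫⁻ y in qball ρ x r, ENNReal.ofReal (w y) ∂μ.restrict 𝒳) /
          μ.restrict 𝒳 (qball ρ x r)) *
        (((∫⁻ y in qball ρ x r, ENNReal.ofReal (w y ^ (-(p - 1)⁻¹)) ∂μ.restrict 𝒳) /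
            μ.restrict 𝒳 (qball ρ x r)) ^ (p - 1)) ≤ ENNReal.ofReal C

end QuasiMetric

/-- The parabolic distance `|x'' - y''| + |t - s|^{1/(2m)}` on `ℝ × ℝ^{d₂}`. -/
def prho (d₂ m : ℕ) (a b : ℝ × Esp d₂) : ℝ :=
  dist a.2 b.2 + |a.1 - b.1| ^ ((2 * m : ℝ))⁻¹

section Derivatives

variable {F : Type*} [NormedAddCommGroup F] [NormedSpace ℝ F]

/-- Spatial partial derivative `D_i` on space-time. -/
def sderiv (d : ℕ) (i : Fin d) (φ : Pt d → F) : Pt d → F :=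
  fun z => fderiv ℝ φ z ((0 : ℝ), EuclideanSpace.single i (1 : ℝ))

/-- Iterated spatial derivative along a list of coordinates. -/
def sderivIter (d : ℕ) (l : List (Fin d)) (φ : Pt d → F) : Pt d → F :=
  l.foldr (fun i ψ => sderiv d i ψ) φ

/-- The list of coordinates of a multi-index. -/
def mIdxList (d : ℕ) (α : Fin d → ℕ) : List (Fin d) :=
  (List.finRange d).foldr (fun i l => List.replicate (α i) i ++ l) []

/-- The spatial derivative `D^α` of a multi-index `α`. -/
def Dpar (d : ℕ) (α : Fin d → ℕ) (φ : Pt d → F) : Pt d → F :=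
  sderivIter d (mIdxList d α) φ

/-- The time derivative `∂_t`. -/
def tderiv (d : ℕ) (φ : Pt d → F) : Pt d → F :=
  fun z => fderiv ℝ φ z ((1 : ℝ), (0 : Esp d))

end Derivatives

/-- The order `|α|` of a multi-index. -/
def deg {d : ℕ} (α : Fin d → ℕ) : ℕ := ∑ i, α i

/-- The finite set of multi-indices of order `≤ k`. -/
def MSet (d k : ℕ) : Finset (Fin d → ℕ) :=
  (Finset.Icc (fun _ => 0) (fun _ => k)).filter fun α => deg α ≤ k

/-- The finite set of multi-indices of order `= k`. -/
def MSetEq (d k : ℕ) : Finset (Fin d → ℕ) :=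
  (Finset.Icc (fun _ => 0) (fun _ => k)).filter fun α => deg α = k

/-- Test functions supported in the open set `U`. -/
def IsTestOn (d : ℕ) (U : Set (Pt d)) (φ : Pt d → ℝ) : Prop :=
  ContDiff ℝ (⊤ : ℕ∞) φ ∧ HasCompactSupport φ ∧ tsupport φ ⊆ U

section Weak

variable {V : Type*} [NormedAddCommGroup V] [NormedSpace ℝ V]

/-- `g` is the spatial weak derivative `D^α u` on `U`. -/
def HasWeakDerivOn (d : ℕ) (U : Set (Pt d)) (α : Fin d → ℕ) (u g : Pt d → V) : Prop :=
  ∀ φ : Pt d → ℝ, IsTestOn d U φ →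
    ∫ z in U, Dpar d α φ z • u z = ((-1 : ℝ) ^ deg α) • ∫ z in U, φ z • g z

/-- `g` is the weak time derivative `u_t` on `U`. -/
def HasWeakTDerivOn (d : ℕ) (U : Set (Pt d)) (u g : Pt d → V) : Prop :=
  ∀ φ : Pt d → ℝ, IsTestOn d U φ →
    ∫ z in U, tderiv d φ z • u z = - ∫ z in U, φ z • g z

end Weak

/-- Assemble a point of `ℝ^d` from its first `d₁` and last `d₂` coordinates. -/
def asm {d₁ d₂ d : ℕ} (hd : d₁ + d₂ = d) (a : Esp d₁) (b : Esp d₂) : Esp d :=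
  (WithLp.equiv 2 (Fin d → ℝ)).symm fun i =>
    Sum.elim (fun j => a j) (fun j => b j) (finSumFinEquiv.symm (Fin.cast hd.symm i))

section MixedNorm

variable {V : Type*} [NormedAddCommGroup V]

/-- The weighted mixed norm `‖f‖_{L_{p,q,w}(U)}` for space-time functions,
with `w(t, x', x'') = w₁(x') w₂(t, x'')`. -/
noncomputable def mnorm {d₁ d₂ d : ℕ} (hd : d₁ + d₂ = d) (U : Set (Pt d)) (p q : ℝ)
    (w₁ : Esp d₁ → ℝ) (w₂ : ℝ × Esp d₂ → ℝ) (f : Pt d → V) : ℝ≥0∞ :=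
  (∫⁻ y : ℝ × Esp d₂,
      (∫⁻ a : Esp d₁,
          ENNReal.ofReal (‖f (y.1, asm hd a y.2)‖ ^ p) *
            Set.indicator U (fun _ => (1 : ℝ≥0∞)) (y.1, asm hd a y.2) *
            ENNReal.ofReal (w₁ a)) ^ (q / p) *
        ENNReal.ofReal (w₂ y)) ^ q⁻¹

/-- `f ∈ L_{p,q,w}(U)`. -/
def MemMnorm {d₁ d₂ d : ℕ} (hd : d₁ + d₂ = d) (U : Set (Pt d)) (p q : ℝ)
    (w₁ : Esp d₁ → ℝ) (w₂ : ℝ × Esp d₂ → ℝ) (f : Pt d → V) : Prop :=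
  AEStronglyMeasurable f (volume.restrict U) ∧ mnorm hd U p q w₁ w₂ f < ⊤

end MixedNorm

/-- `A.mulVec v` for an `ℓ × ℓ` complex matrix given as an iterated function. -/
def mApply {l : ℕ} (M : Fin l → Fin l → ℂ) (v : Fin l → ℂ) : Fin l → ℂ :=
  fun i => ∑ j, M i j * v j

/-- The Legendre–Hadamard ellipticity condition with constant `δ` for the leading
coefficients of a `2m`-th order system. -/
def LegendreHadamard (d m l : ℕ) (δ : ℝ)
    (A : (Fin d → ℕ) → (Fin d → ℕ) → Pt d → (Fin l → Fin l → ℂ)) : Prop :=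
  ∀ z : Pt d, ∀ ξ : Fin d → ℝ, ∀ θ : Fin l → ℂ,
    δ * (∑ i, ξ i ^ 2) ^ m * (∑ i, Complex.normSq (θ i)) ≤
      (∑ α ∈ MSetEq d m, ∑ β ∈ MSetEq d m,
        (((∏ i, ξ i ^ α i) * ∏ i, ξ i ^ β i : ℝ) : ℂ) *
          ∑ i, ∑ j, θ i * A α β z i j * (starRingEnd ℂ) (θ j)).re

/-- Boundedness of the coefficients: `|A^{αβ}| ≤ δ⁻¹` for `|α| = |β| = m` and
`|A^{αβ}| ≤ K` otherwise. -/
def CoeffBounds (d m l : ℕ) (δ K : ℝ)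
    (A : (Fin d → ℕ) → (Fin d → ℕ) → Pt d → (Fin l → Fin l → ℂ)) : Prop :=
  (∀ α ∈ MSetEq d m, ∀ β ∈ MSetEq d m, ∀ z i j, ‖A α β z i j‖ ≤ δ⁻¹) ∧
  (∀ α ∈ MSet d m, ∀ β ∈ MSet d m, ¬(deg α = m ∧ deg β = m) →
    ∀ z i j, ‖A α β z i j‖ ≤ K)

/-- The sharp function `g^{#,1}_R`: supremum over parabolic cylinders `Q_r(s,y)`, `r ≤ R`,
of the mean oscillation in the spatial variables only. -/
noncomputable def sharpX (d m : ℕ) {W : Type*} [NormedAddCommGroup W] [NormedSpace ℝ W]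
    (g : Pt d → W) (R : ℝ) : ℝ :=
  ⨆ (s : ℝ) (y : Esp d) (r : ℝ) (_ : 0 < r) (_ : r ≤ R),
    (r ^ (2 * m))⁻¹ *
      ∫ τ in Set.Ioo (s - r ^ (2 * m)) s,
        ⨍ z in Metric.ball y r,
          ‖g (τ, z) - ⨍ z' in Metric.ball y r, g (τ, z') ∂volume‖ ∂volume

/-- Assumption (regularity in `x`): the leading coefficients have mean oscillation in the
spatial variables at most `γ` in parabolic cylinders of size `≤ R₀`, measurably in time. -/
def AssumptionX (d m l : ℕ) (γ R₀ : ℝ)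
    (A : (Fin d → ℕ) → (Fin d → ℕ) → Pt d → (Fin l → Fin l → ℂ)) : Prop :=
  ∑ α ∈ MSetEq d m, ∑ β ∈ MSetEq d m, sharpX d m (fun z => A α β z) R₀ ≤ γ

section SmoothSolutions

open scoped FourierTransform Topology ContDiff RealInnerProductSpace

/-! ### Calculus of the partial derivatives -/

section Calculus

variable {d : ℕ} {F : Type*} [NormedAddCommGroup F] [NormedSpace ℝ F]

lemma contDiff_fderiv_apply_const {E : Type*} [NormedAddCommGroup E] [NormedSpace ℝ E]
    {φ : E → F} (hφ : ContDiff ℝ ∞ φ) (v : E) : ContDiff ℝ ∞ fun z => fderiv ℝ φ z v :=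
  (hφ.fderiv_right (m := ∞) (by simp)).clm_apply contDiff_const

lemma fderiv_fderiv_apply_comm {E : Type*} [NormedAddCommGroup E] [NormedSpace ℝ E]
    {φ : E → F} (hφ : ContDiff ℝ ∞ φ) (v w z : E) :
    fderiv ℝ (fun y => fderiv ℝ φ y v) z w = fderiv ℝ (fun y => fderiv ℝ φ y w) z v := by
  have hd : DifferentiableAt ℝ (fderiv ℝ φ) z :=
    (hφ.fderiv_right (m := ∞) (by simp)).differentiable (by simp) z
  have hs := hφ.contDiffAt (x := z) |>.isSymmSndFDerivAt (by simp; exact WithTop.coe_le_coe.2 le_top)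
  rw [fderiv_clm_apply hd (differentiableAt_const v), fderiv_clm_apply hd (differentiableAt_const w)]
  simpa using hs w v

lemma ContDiff.sderiv {φ : Pt d → F} (hφ : ContDiff ℝ ∞ φ) (i : Fin d) :
    ContDiff ℝ ∞ (sderiv d i φ) :=
  contDiff_fderiv_apply_const hφ _

lemma ContDiff.tderiv {φ : Pt d → F} (hφ : ContDiff ℝ ∞ φ) : ContDiff ℝ ∞ (tderiv d φ) :=
  contDiff_fderiv_apply_const hφ _

lemma ContDiff.sderivIter {φ : Pt d → F} (hφ : ContDiff ℝ ∞ φ) (L : List (Fin d)) :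
    ContDiff ℝ ∞ (sderivIter d L φ) := by
  induction L with
  | nil => exact hφ
  | cons i L ih => exact ih.sderiv i

lemma sderiv_tderiv_comm {φ : Pt d → F} (hφ : ContDiff ℝ ∞ φ) (i : Fin d) :
    sderiv d i (tderiv d φ) = tderiv d (sderiv d i φ) :=
  funext fun z => fderiv_fderiv_apply_comm hφ _ _ z

lemma sderiv_sderivIter_comm {φ : Pt d → F} (hφ : ContDiff ℝ ∞ φ) (i : Fin d)
    (L : List (Fin d)) : sderiv d i (sderivIter d L φ) = sderivIter d L (sderiv d i φ) := by
  induction L with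
  | nil => rfl
  | cons j L ih =>
    change sderiv d i (sderiv d j (sderivIter d L φ)) = sderiv d j (sderivIter d L (sderiv d i φ))
    rw [← ih]
    exact funext fun z => fderiv_fderiv_apply_comm (hφ.sderivIter L) _ _ z

lemma hasDerivAt_time {φ : Pt d → F} (hφ : ContDiff ℝ ∞ φ) (t : ℝ) (x : Esp d) :
    HasDerivAt (fun s => φ (s, x)) (tderiv d φ (t, x)) t := by
  have h := (hφ.differentiable (by simp) (t, x)).hasFDerivAt
  exact h.comp_hasDerivAt t ((hasDerivAt_id t).prodMk (hasDerivAt_const t x))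

lemma hasFDerivAt_space {φ : Pt d → F} (hφ : ContDiff ℝ ∞ φ) (t : ℝ) (x : Esp d) :
    HasFDerivAt (fun y => φ (t, y))
      ((fderiv ℝ φ (t, x)).comp (ContinuousLinearMap.inr ℝ ℝ (Esp d))) x :=
  (hφ.differentiable (by simp) (t, x)).hasFDerivAt.comp x (hasFDerivAt_prodMk_right t x)

lemma fderiv_space_apply_single {φ : Pt d → F} (hφ : ContDiff ℝ ∞ φ) (t : ℝ) (x : Esp d)
    (i : Fin d) :
    fderiv ℝ (fun y => φ (t, y)) x (EuclideanSpace.single i 1) = sderiv d i φ (t, x) := by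
  rw [(hasFDerivAt_space hφ t x).fderiv]
  simp [sderiv]

lemma length_mIdxList (α : Fin d → ℕ) : (mIdxList d α).length = deg α := by
  have h : ∀ L : List (Fin d),
      (L.foldr (fun i l => List.replicate (α i) i ++ l) []).length = (L.map α).sum := by
    intro L
    induction L with
    | nil => rfl
    | cons i L ih =>
      rw [List.foldr_cons, List.length_append, ih]
      simp
  rw [mIdxList, h, deg, Fin.sum_univ_def]

lemma prod_map_mIdxList {R : Type*} [CommMonoid R] (α : Fin d → ℕ) (f : Fin d → R) :
    ((mIdxList d α).map f).prod = ∏ i, f i ^ α i := by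
  have h : ∀ L : List (Fin d),
      ((L.foldr (fun i l => List.replicate (α i) i ++ l) []).map f).prod
        = (L.map fun i => f i ^ α i).prod := by
    intro L
    induction L with
    | nil => rfl
    | cons i L ih =>
      rw [List.foldr_cons, List.map_append, List.prod_append, ih]
      simp
  rw [mIdxList, h, Fin.prod_univ_def]

end Calculus

/-! ### Spatial cutoffs and the Fourier transform of localized functions -/

/-- Smooth functions with compact support in the spatial ball of radius `4`. -/
def IsCutoff (d : ℕ) (ζ : Esp d → ℝ) : Prop :=
  ContDiff ℝ ∞ ζ ∧ HasCompactSupport ζ ∧ tsupport ζ ⊆ Metric.ball 0 4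

/-- The Fourier transform in space of `ζ v(t, ·)`. -/
def locFourier {d l : ℕ} (ζ : Esp d → ℝ) (v : Pt d → Fin l → ℂ) (t : ℝ) (ξ : Esp d) :
    Fin l → ℂ :=
  𝓕 (fun x => ζ x • v (t, x)) ξ

section Localized

variable {d l : ℕ} {ζ : Esp d → ℝ} {v : Pt d → Fin l → ℂ}

lemma IsCutoff.partialDeriv (hζ : IsCutoff d ζ) (i : Fin d) :
    IsCutoff d fun x => fderiv ℝ ζ x (EuclideanSpace.single i 1) :=
  ⟨contDiff_fderiv_apply_const hζ.1 _, hζ.2.1.fderiv_apply ℝ _,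
    (tsupport_fderiv_apply_subset ℝ _).trans hζ.2.2⟩

lemma IsCutoff.eq_zero (hζ : IsCutoff d ζ) {x : Esp d} (hx : x ∉ Metric.ball (0 : Esp d) 4) :
    ζ x = 0 :=
  image_eq_zero_of_notMem_tsupport fun h => hx (hζ.2.2 h)

lemma IsCutoff.exists_bound (hζ : IsCutoff d ζ) : ∃ C, 0 ≤ C ∧ ∀ x, ‖ζ x‖ ≤ C := by
  obtain ⟨C, hC⟩ := hζ.2.1.exists_bound_of_continuous hζ.1.continuous
  exact ⟨C, (norm_nonneg _).trans (hC 0), hC⟩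

lemma IsCutoff.integrable_smul (hζ : IsCutoff d ζ) {f : Esp d → Fin l → ℂ} (hf : Continuous f) :
    Integrable fun x => ζ x • f x :=
  (hζ.1.continuous.smul hf).integrable_of_hasCompactSupport hζ.2.1.smul_right

lemma locFourier_eq (t : ℝ) (ξ : Esp d) :
    locFourier ζ v t ξ =
      ∫ x, Complex.exp (↑(-2 * Real.pi * ⟪x, ξ⟫) * Complex.I) • ζ x • v (t, x) := by
  rw [locFourier, Real.fourier_eq']

lemma locFourier_sderiv (hζ : IsCutoff d ζ) (hv : ContDiff ℝ ∞ v) (i : Fin d) (t : ℝ)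
    (ξ : Esp d) :
    locFourier ζ (sderiv d i v) t ξ = (2 * Real.pi * Complex.I * ξ i : ℂ) • locFourier ζ v t ξ -
      locFourier (fun x => fderiv ℝ ζ x (EuclideanSpace.single i 1)) v t ξ := by
  have hvt : ContDiff ℝ ∞ fun x => v (t, x) := hv.comp (contDiff_const.prodMk contDiff_id)
  have hg : ContDiff ℝ ∞ fun x => ζ x • v (t, x) := hζ.1.smul hvt
  have hsupp : HasCompactSupport fun x => ζ x • v (t, x) := hζ.2.1.smul_right
  have hint : Integrable (fderiv ℝ fun x => ζ x • v (t, x)) :=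
    ((hg.fderiv_right (m := ∞) (by simp)).continuous).integrable_of_hasCompactSupport
      (hsupp.fderiv ℝ)
  have key := congrArg (fun f => f ξ (EuclideanSpace.single i 1))
    (Real.fourier_fderiv (hζ.integrable_smul hvt.continuous) (hg.differentiable (by simp)) hint)
  simp only [Real.fourier_continuousLinearMap_apply hint] at key
  have hd : ∀ x, fderiv ℝ (fun x => ζ x • v (t, x)) x (EuclideanSpace.single i 1) =
      ζ x • sderiv d i v (t, x) + fderiv ℝ ζ x (EuclideanSpace.single i 1) • v (t, x) := by
    intro x
    rw [fderiv_fun_smul (hζ.1.differentiable (by simp) x) (hvt.differentiable (by simp) x)]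
    simp [fderiv_space_apply_single hv]
  simp only [hd] at key
  rw [eq_sub_iff_add_eq]
  have hadd : 𝓕 (fun x => ζ x • sderiv d i v (t, x) +
        fderiv ℝ ζ x (EuclideanSpace.single i 1) • v (t, x)) ξ =
      locFourier ζ (sderiv d i v) t ξ +
        locFourier (fun x => fderiv ℝ ζ x (EuclideanSpace.single i 1)) v t ξ := by
    have h1 : Integrable fun x => ζ x • sderiv d i v (t, x) :=
      hζ.integrable_smul ((hv.sderiv i).continuous.comp (by fun_prop))
    have h2 : Integrable fun x => fderiv ℝ ζ x (EuclideanSpace.single i 1) • v (t, x) :=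
      (hζ.partialDeriv i).integrable_smul hvt.continuous
    rw [locFourier, locFourier, Real.fourier_eq, Real.fourier_eq, Real.fourier_eq,
      ← integral_add ((Real.fourierIntegral_convergent_iff ξ).2 h1)
        ((Real.fourierIntegral_convergent_iff ξ).2 h2)]
    exact integral_congr_ae (ae_of_all _ fun x => smul_add _ _ _)
  rw [← hadd, key, VectorFourier.fourierSMulRight_apply]
  ext j
  have hin : (-innerSL ℝ) ξ (EuclideanSpace.single i (1 : ℝ)) = -ξ i := by
    rw [neg_apply, neg_apply, innerSL_apply_apply,
      EuclideanSpace.inner_single_right]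
    simp
  rw [hin]
  simp [locFourier, mul_assoc]

lemma norm_locFourier_le (hζ : IsCutoff d ζ) {C : ℝ} (hC : ∀ x, ‖ζ x‖ ≤ C)
    (hv : ContDiff ℝ ∞ v) (t : ℝ) (ξ : Esp d) :
    ‖locFourier ζ v t ξ‖ ≤ C * ∫ x in Metric.ball (0 : Esp d) 4, ‖v (t, x)‖ := by
  have hvt : Continuous fun x : Esp d => v (t, x) := hv.continuous.comp (by fun_prop)
  rw [locFourier_eq]
  refine (norm_integral_le_integral_norm _).trans ?_
  rw [← integral_const_mul, ← setIntegral_eq_integral_of_forall_compl_eq_zero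
    (s := Metric.ball (0 : Esp d) 4)]
  · refine setIntegral_mono_on ?_ ?_ Metric.isOpen_ball.measurableSet ?_
    · simp only [norm_smul, Complex.norm_exp_ofReal_mul_I, one_mul]
      simpa only [norm_smul] using (hζ.integrable_smul hvt).norm.integrableOn
    · exact ((continuous_const.mul hvt.norm).continuousOn.integrableOn_compact
        (isCompact_closedBall (0 : Esp d) 4)).mono_set Metric.ball_subset_closedBall
    · intro x _
      rw [norm_smul, Complex.norm_exp_ofReal_mul_I, one_mul, norm_smul]
      exact mul_le_mul_of_nonneg_right (hC x) (norm_nonneg _)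
  · intro x hx
    simp [hζ.eq_zero hx]

lemma continuous_locFourier (hζ : IsCutoff d ζ) (hv : Continuous v) (ξ : Esp d) :
    Continuous fun t => locFourier ζ v t ξ := by
  have h : ∀ t, locFourier ζ v t ξ = ∫ x in tsupport ζ,
      Complex.exp (↑(-2 * Real.pi * ⟪x, ξ⟫) * Complex.I) • ζ x • v (t, x) := by
    intro t
    rw [locFourier_eq, setIntegral_eq_integral_of_forall_compl_eq_zero]
    intro x hx
    simp [image_eq_zero_of_notMem_tsupport hx]
  simp_rw [h]
  refine continuous_parametric_integral_of_continuous ?_ hζ.2.1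
  have hζc := hζ.1.continuous
  have he : Continuous fun p : ℝ × Esp d =>
      Complex.exp (↑(-2 * Real.pi * ⟪p.2, ξ⟫) * Complex.I) := by fun_prop
  exact he.smul ((hζc.comp continuous_snd).smul hv)

lemma hasDerivAt_locFourier (hζ : IsCutoff d ζ) (hv : ContDiff ℝ ∞ v) (t : ℝ) (ξ : Esp d) :
    HasDerivAt (fun t => locFourier ζ v t ξ) (locFourier ζ (tderiv d v) t ξ) t := by
  have hζc := hζ.1.continuous
  have hvc := hv.continuous
  have hv'c := hv.tderiv.continuous
  have hcont : ∀ w : Pt d → Fin l → ℂ, Continuous w → ∀ s, Continuous fun x =>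
      Complex.exp (↑(-2 * Real.pi * ⟪x, ξ⟫) * Complex.I) • ζ x • w (s, x) := by
    intro w hw s
    have he : Continuous fun x : Esp d =>
      Complex.exp (↑(-2 * Real.pi * ⟪x, ξ⟫) * Complex.I) := by fun_prop
    exact he.smul (hζc.smul (hw.comp (by fun_prop)))
  have hsupp : ∀ w : Pt d → Fin l → ℂ, ∀ s, HasCompactSupport fun x =>
      Complex.exp (↑(-2 * Real.pi * ⟪x, ξ⟫) * Complex.I) • ζ x • w (s, x) :=
    fun w s => hζ.2.1.mono fun x hx h0 => hx (by simp [h0])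
  obtain ⟨C, hC⟩ := (isCompact_Icc (a := t - 1) (b := t + 1) |>.prod
    hζ.2.1.isCompact).exists_bound_of_continuousOn hv'c.continuousOn
  simp_rw [locFourier_eq]
  refine (hasDerivAt_integral_of_dominated_loc_of_deriv_le (bound := fun x => ‖ζ x‖ * C)
    (F' := fun s x => Complex.exp (↑(-2 * Real.pi * ⟪x, ξ⟫) * Complex.I) •
      ζ x • tderiv d v (s, x))
    (Icc_mem_nhds (by linarith) (by linarith) : Set.Icc (t - 1) (t + 1) ∈ 𝓝 t)
    (Eventually.of_forall fun s => (hcont v hvc s).aestronglyMeasurable)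
    ((hcont v hvc t).integrable_of_hasCompactSupport (hsupp v t))
    (hcont _ hv'c t).aestronglyMeasurable (ae_of_all _ fun x s hs => ?_) ?_
    (ae_of_all _ fun x s _ => ?_)).2
  · rw [norm_smul, Complex.norm_exp_ofReal_mul_I, one_mul, norm_smul]
    by_cases hx : x ∈ tsupport ζ
    · exact mul_le_mul_of_nonneg_left (hC (s, x) ⟨hs, hx⟩) (norm_nonneg _)
    · simp [image_eq_zero_of_notMem_tsupport hx]
  · exact (hζc.norm.integrable_of_hasCompactSupport hζ.2.1.norm).mul_const C
  · have h := (hasDerivAt_time hv s x).const_smul (ζ x)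
    exact h.const_smul (Complex.exp (↑(-2 * Real.pi * ⟪x, ξ⟫) * Complex.I))

end Localized

/-! ### A scalar differential inequality -/

lemma sqrt_add_integral_le {a b p : ℝ} (hp : 0 ≤ p) {y y' k : ℝ → ℝ}
    (hy : ∀ t, HasDerivAt y (y' t) t) (hy0 : ∀ t, 0 ≤ y t) (hya : y a = 0)
    (hk : Continuous k) (hk0 : ∀ t, 0 ≤ k t)
    (hineq : ∀ t ∈ Set.Ioo a b, y' t ≤ -2 * p * y t + 2 * √(y t) * k t) {t : ℝ}
    (ht : t ∈ Set.Icc a b) :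
    √(y t) + p * ∫ s in a..t, √(y s) ≤ ∫ s in a..t, k s := by
  have hyc : Continuous y := continuous_iff_continuousAt.2 fun t => (hy t).continuousAt
  have hsc : Continuous fun s => √(y s) := hyc.sqrt
  have main : ∀ ε > 0, √(y t) + p * (∫ s in a..t, √(y s)) - ∫ s in a..t, k s ≤
      ε * (1 + p * (t - a)) := by
    intro ε hε
    set H : ℝ → ℝ := fun t => √(y t + ε ^ 2) + p * (∫ s in a..t, √(y s)) -
      (∫ s in a..t, k s) - p * ε * t with hH
    have hpos : ∀ s, 0 < y s + ε ^ 2 := fun s => by have := hy0 s; positivity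
    have hder : ∀ s, HasDerivAt H
        (y' s / (2 * √(y s + ε ^ 2)) + p * √(y s) - k s - p * ε) s := by
      intro s
      have h1 := ((hy s).add_const (ε ^ 2)).sqrt (hpos s).ne'
      have h2 := (hsc.integral_hasStrictDerivAt a s).hasDerivAt.const_mul p
      have h3 := (hk.integral_hasStrictDerivAt a s).hasDerivAt
      exact (((h1.add h2).sub h3).sub ((hasDerivAt_id s).const_mul (p * ε))).congr_deriv (by simp)
    have hanti : AntitoneOn H (Set.Icc a b) := by
      refine antitoneOn_of_deriv_nonpos (convex_Icc a b)
        (fun s _ => (hder s).continuousAt.continuousWithinAt)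
        (fun s _ => (hder s).differentiableAt.differentiableWithinAt) fun s hs => ?_
      rw [interior_Icc] at hs
      rw [(hder s).deriv]
      set h := √(y s + ε ^ 2) with hh
      set r := √(y s) with hr
      have hhpos : 0 < h := Real.sqrt_pos.2 (hpos s)
      have hr0 : 0 ≤ r := Real.sqrt_nonneg _
      have hrsq : r * r = y s := Real.mul_self_sqrt (hy0 s)
      have hhsq : h * h = y s + ε ^ 2 := Real.mul_self_sqrt (hpos s).le
      have hrh : r ≤ h := Real.sqrt_le_sqrt (by nlinarith)
      have hhr : h ≤ r + ε := by nlinarith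
      have hle : y' s / (2 * h) ≤ (-p * r * r + r * k s) / h := by
        rw [div_le_div_iff₀ (by positivity) hhpos]
        have h1 : y' s ≤ -2 * p * (r * r) + 2 * r * k s := by
          rw [hrsq]
          exact hineq s hs
        have h2 := mul_le_mul_of_nonneg_right h1 hhpos.le
        linarith
      have hle2 : (-p * r * r + r * k s) / h ≤ k s + p * ε - p * r := by
        rw [div_le_iff₀ hhpos]
        have e1 : r * k s ≤ k s * h := by nlinarith [hk0 s]
        have e2 : p * (r * h) ≤ p * (r * r + ε * h) := by
          apply mul_le_mul_of_nonneg_left _ hp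
          nlinarith
        nlinarith
      linarith
    have hle := hanti (Set.left_mem_Icc.2 (ht.1.trans ht.2)) ht ht.1
    have hsq : √(y t) ≤ √(y t + ε ^ 2) := Real.sqrt_le_sqrt (by nlinarith)
    simp only [hH, hya, intervalIntegral.integral_same, zero_add, Real.sqrt_sq hε.le] at hle
    nlinarith
  have hc : 0 ≤ 1 + p * (t - a) := by nlinarith [ht.1]
  by_contra! hcon
  set X := √(y t) + p * (∫ s in a..t, √(y s)) - ∫ s in a..t, k s with hX
  have hXpos : 0 < X := by linarith
  have hc' : 0 < 1 + p * (t - a) := by nlinarith [ht.1, mul_nonneg hp (sub_nonneg.2 ht.1)]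
  have := main (X / (2 * (1 + p * (t - a)))) (by positivity)
  rw [div_mul_eq_mul_div, mul_div_mul_right _ _ hc'.ne'] at this
  linarith

/-! ### Local solutions -/

/-- `v` is a smooth solution of `v_t + (-1)^m L v + λ v = 0` in `Q₄`, the operator `L` having
bounded elliptic coefficients which depend on time only. -/
structure IsLocalSolution (d m l : ℕ) (δ : ℝ)
    (A : (Fin d → ℕ) → (Fin d → ℕ) → ℝ → (Fin l → Fin l → ℂ)) (lam : ℝ)
    (v : Pt d → Fin l → ℂ) : Prop where
  elliptic : LegendreHadamard d m l δ fun α β z => A α β z.1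
  bound : ∀ α ∈ MSetEq d m, ∀ β ∈ MSetEq d m, ∀ t i j, ‖A α β t i j‖ ≤ δ⁻¹
  nonneg : 0 ≤ lam
  smooth : ContDiff ℝ ∞ v
  eqn : ∀ᵐ t ∂volume.restrict (Set.Ioo (-(4 : ℝ) ^ (2 * m)) 0), ∀ x ∈ Metric.ball (0 : Esp d) 4,
    tderiv d v (t, x) + ((-1 : ℝ) ^ m) • (∑ α ∈ MSetEq d m, ∑ β ∈ MSetEq d m,
      mApply (A α β t) (Dpar d (α + β) v (t, x))) + lam • v (t, x) = 0

/-- `mApply M` as a continuous linear map. -/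
def mApplyCLM {l : ℕ} (M : Fin l → Fin l → ℂ) : (Fin l → ℂ) →L[ℂ] (Fin l → ℂ) :=
  LinearMap.toContinuousLinearMap
    { toFun := mApply M
      map_add' := fun v w => by
        ext i
        simp [mApply, mul_add, Finset.sum_add_distrib]
      map_smul' := fun c v => by
        ext i
        simp [mApply, Finset.mul_sum, mul_left_comm] }

@[simp] lemma mApplyCLM_apply {l : ℕ} (M : Fin l → Fin l → ℂ) (v : Fin l → ℂ) :
    mApplyCLM M v = mApply M v := rfl

lemma norm_mApply_le {l : ℕ} {M : Fin l → Fin l → ℂ} {C : ℝ} (hC0 : 0 ≤ C)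
    (hC : ∀ i j, ‖M i j‖ ≤ C) (v : Fin l → ℂ) : ‖mApply M v‖ ≤ l * C * ‖v‖ := by
  refine (pi_norm_le_iff_of_nonneg (by positivity)).2 fun i => ?_
  calc ‖∑ j, M i j * v j‖ ≤ ∑ _j : Fin l, C * ‖v‖ :=
        norm_sum_le_of_le _ fun j _ => by
          rw [norm_mul]
          exact mul_le_mul (hC i j) (norm_le_pi_norm v j) (norm_nonneg _) hC0
    _ = l * C * ‖v‖ := by simp [mul_assoc]

section Solutions

variable {d m l : ℕ} {δ : ℝ} {A : (Fin d → ℕ) → (Fin d → ℕ) → ℝ → (Fin l → Fin l → ℂ)}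
  {lam : ℝ} {v : Pt d → Fin l → ℂ}

lemma isLocalSolution_of_ae (hLH : LegendreHadamard d m l δ fun α β z => A α β z.1)
    (hA : ∀ α ∈ MSetEq d m, ∀ β ∈ MSetEq d m, ∀ t i j, ‖A α β t i j‖ ≤ δ⁻¹) (hlam : 0 ≤ lam)
    (hv : ContDiff ℝ ∞ v)
    (h : ∀ᵐ z ∂volume.restrict
        ((Set.Ioo (-(4 : ℝ) ^ (2 * m)) 0) ×ˢ Metric.ball (0 : Esp d) 4),
      tderiv d v z + ((-1 : ℝ) ^ m) • (∑ α ∈ MSetEq d m, ∑ β ∈ MSetEq d m,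
        mApply (A α β z.1) (Dpar d (α + β) v z)) + lam • v z = 0) :
    IsLocalSolution d m l δ A lam v := by
  refine ⟨hLH, hA, hlam, hv, ?_⟩
  rw [Measure.volume_eq_prod, ← Measure.prod_restrict] at h
  filter_upwards [Measure.ae_ae_of_ae_prod h] with t ht
  have hcont : Continuous fun x => tderiv d v (t, x) + ((-1 : ℝ) ^ m) • (∑ α ∈ MSetEq d m,
      ∑ β ∈ MSetEq d m, mApplyCLM (A α β t) (Dpar d (α + β) v (t, x))) + lam • v (t, x) := by
    have hp : Continuous fun x : Esp d => (t, x) := by fun_prop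
    refine ((hv.tderiv.continuous.comp hp).add (Continuous.const_smul
      (continuous_finsetSum _ fun α _ => continuous_finsetSum _ fun β _ => ?_) ((-1 : ℝ) ^ m))).add
      ((hv.continuous.comp hp).const_smul lam)
    exact (mApplyCLM (A α β t)).continuous.comp ((hv.sderivIter _).continuous.comp hp)
  exact fun x hx => Measure.eqOn_open_of_ae_eq ht Metric.isOpen_ball hcont.continuousOn
    continuousOn_const hx

lemma IsLocalSolution.sderiv (hv : IsLocalSolution d m l δ A lam v) (i : Fin d) :
    IsLocalSolution d m l δ A lam (sderiv d i v) := by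
  refine ⟨hv.elliptic, hv.bound, hv.nonneg, hv.smooth.sderiv i, ?_⟩
  filter_upwards [hv.eqn] with t ht x hx
  have hd : ∀ φ : Pt d → Fin l → ℂ, ContDiff ℝ ∞ φ →
      HasDerivAt (fun s : ℝ => φ (t, x + s • EuclideanSpace.single i 1)) (_root_.sderiv d i φ (t, x))
        0 := by
    intro φ hφ
    have h1 : HasDerivAt (fun s : ℝ => (t, x + s • EuclideanSpace.single i (1 : ℝ)))
        ((0 : ℝ), EuclideanSpace.single i (1 : ℝ)) 0 := by
      simpa using (hasDerivAt_const (0 : ℝ) t).prodMk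
        (((hasDerivAt_id (0 : ℝ)).smul_const (EuclideanSpace.single i (1 : ℝ))).const_add x)
    have h2 : HasFDerivAt φ (fderiv ℝ φ (t, x))
        (t, x + (0 : ℝ) • EuclideanSpace.single i (1 : ℝ)) := by
      simpa using (hφ.differentiable (by simp) (t, x)).hasFDerivAt
    exact h2.comp_hasDerivAt 0 h1
  have hE := ((hd _ hv.smooth.tderiv).add ((HasDerivAt.fun_sum fun α (_ : α ∈ MSetEq d m) =>
    HasDerivAt.fun_sum fun β (_ : β ∈ MSetEq d m) =>
      ((mApplyCLM (A α β t)).restrictScalars ℝ).hasFDerivAt.comp_hasDerivAt 0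
        (hd _ (hv.smooth.sderivIter (mIdxList d (α + β))))).const_smul ((-1 : ℝ) ^ m))).add
    ((hd _ hv.smooth).const_smul lam)
  have hev : ∀ᶠ s : ℝ in 𝓝 0, x + s • EuclideanSpace.single i (1 : ℝ) ∈
      Metric.ball (0 : Esp d) 4 := by
    have hc : Continuous fun s : ℝ => x + s • EuclideanSpace.single i (1 : ℝ) := by fun_prop
    exact hc.continuousAt.eventually (Metric.isOpen_ball.mem_nhds (by simpa using hx))
  have h0 := (hE.congr_of_eventuallyEq (f₁ := fun _ => 0)
    (hev.mono fun s hs => (ht _ hs).symm)).unique (hasDerivAt_const 0 0)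
  rw [sderiv_tderiv_comm hv.smooth] at h0
  simp_rw [sderiv_sderivIter_comm hv.smooth] at h0
  exact h0

lemma IsLocalSolution.sderivIter (hv : IsLocalSolution d m l δ A lam v) (L : List (Fin d)) :
    IsLocalSolution d m l δ A lam (sderivIter d L v) := by
  induction L with
  | nil => exact hv
  | cons i L ih => exact ih.sderiv i

end Solutions

/-! ### The energy inequality at a fixed frequency -/

/-- The difference between the localized Fourier transform of a derivative and the symbol of the
derivative times the localized Fourier transform. -/
def symbolDefect {d l : ℕ} (ζ : Esp d → ℝ) (v : Pt d → Fin l → ℂ) (L : List (Fin d)) (t : ℝ)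
    (ξ : Esp d) : Fin l → ℂ :=
  locFourier ζ (sderivIter d L v) t ξ -
    (L.map fun i => (2 * Real.pi * Complex.I * ξ i : ℂ)).prod • locFourier ζ v t ξ

section Energy

variable {d m l : ℕ} {δ : ℝ} {A : (Fin d → ℕ) → (Fin d → ℕ) → ℝ → (Fin l → Fin l → ℂ)}
  {lam : ℝ} {v : Pt d → Fin l → ℂ} {ζ : Esp d → ℝ}

lemma continuous_symbolDefect (hζ : IsCutoff d ζ) (hv : ContDiff ℝ ∞ v) (L : List (Fin d))
    (ξ : Esp d) : Continuous fun t => symbolDefect ζ v L t ξ := by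
  have h := continuous_locFourier hζ hv.continuous ξ
  have h' := continuous_locFourier hζ (hv.sderivIter L).continuous ξ
  exact h'.sub (h.const_smul (L.map fun i => (2 * Real.pi * Complex.I * ξ i : ℂ)).prod)

lemma deg_of_mem_MSetEq {k : ℕ} {α : Fin d → ℕ} (hα : α ∈ MSetEq d k) : deg α = k :=
  (Finset.mem_filter.1 hα).2

lemma symbol_eq {α β : Fin d → ℕ} (hα : deg α = m) (hβ : deg β = m) (ξ : Esp d) :
    ((mIdxList d (α + β)).map fun i => (2 * Real.pi * Complex.I * ξ i : ℂ)).prod =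
      (-1) ^ m * (((∏ i, (2 * Real.pi * ξ i) ^ α i) * ∏ i, (2 * Real.pi * ξ i) ^ β i : ℝ) : ℂ) := by
  have h : ∀ i, (2 * Real.pi * Complex.I * ξ i : ℂ) =
      Complex.I * ((2 * Real.pi * ξ i : ℝ) : ℂ) := fun i => by
    push_cast
    ring
  rw [prod_map_mIdxList]
  simp only [Pi.add_apply, h, mul_pow, Finset.prod_mul_distrib, Finset.prod_pow_eq_pow_sum,
    pow_add, Complex.ofReal_mul, Complex.ofReal_prod, Complex.ofReal_pow]
  change Complex.I ^ deg α * _ * (Complex.I ^ deg β * _) = _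
  rw [hα, hβ, ← Complex.I_sq, ← pow_mul, two_mul, pow_add]
  ring

lemma locFourier_tderiv_eq (hv : IsLocalSolution d m l δ A lam v) (hζ : IsCutoff d ζ) {t : ℝ}
    (ht : ∀ x ∈ Metric.ball (0 : Esp d) 4,
      tderiv d v (t, x) + ((-1 : ℝ) ^ m) • (∑ α ∈ MSetEq d m, ∑ β ∈ MSetEq d m,
        mApply (A α β t) (Dpar d (α + β) v (t, x))) + lam • v (t, x) = 0) (ξ : Esp d) :
    locFourier ζ (tderiv d v) t ξ =
      -(((-1 : ℂ) ^ m) • ∑ α ∈ MSetEq d m, ∑ β ∈ MSetEq d m,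
        mApply (A α β t) (locFourier ζ (Dpar d (α + β) v) t ξ)) -
        (lam : ℂ) • locFourier ζ v t ξ := by
  set e : Esp d → ℂ := fun x => Complex.exp (↑(-2 * Real.pi * ⟪x, ξ⟫) * Complex.I) with he
  have hint : ∀ w : Pt d → Fin l → ℂ, Continuous w → Integrable fun x => e x • ζ x • w (t, x) := by
    intro w hw
    have hec : Continuous e := by
      rw [he]
      fun_prop
    exact (hec.smul (hζ.1.continuous.smul (hw.comp (by fun_prop)))).integrable_of_hasCompactSupport
      (hζ.2.1.mono fun x hx h0 => hx (by simp [h0]))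
  have hD : ∀ α β : Fin d → ℕ, Integrable fun x => e x • ζ x • Dpar d (α + β) v (t, x) :=
    fun α β => hint _ (hv.smooth.sderivIter _).continuous
  have hDA : ∀ α β : Fin d → ℕ, Integrable fun x =>
      mApplyCLM (A α β t) (e x • ζ x • Dpar d (α + β) v (t, x)) :=
    fun α β => (mApplyCLM (A α β t)).integrable_comp (hD α β)
  have hpt : ∀ x, e x • ζ x • tderiv d v (t, x) =
      -(((-1 : ℂ) ^ m) • ∑ α ∈ MSetEq d m, ∑ β ∈ MSetEq d m,
        mApplyCLM (A α β t) (e x • ζ x • Dpar d (α + β) v (t, x))) -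
        (lam : ℂ) • (e x • ζ x • v (t, x)) := by
    intro x
    by_cases hx : x ∈ Metric.ball (0 : Esp d) 4
    · have h := eq_neg_of_add_eq_zero_left ((add_assoc _ _ _).symm.trans (ht x hx))
      have hmap : ∀ α β, mApplyCLM (A α β t) (e x • ζ x • Dpar d (α + β) v (t, x)) =
          e x • ζ x • mApply (A α β t) (Dpar d (α + β) v (t, x)) := fun α β => by
        rw [map_smul, ← Complex.coe_smul, map_smul, Complex.coe_smul, mApplyCLM_apply]
      simp_rw [h, hmap, ← Finset.smul_sum]
      ext j
      simp only [Pi.smul_apply, Pi.neg_apply, Pi.add_apply, Pi.sub_apply, smul_eq_mul,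
        Complex.real_smul]
      push_cast
      ring
    · simp only [hζ.eq_zero hx, zero_smul, smul_zero, map_zero, Finset.sum_const_zero, neg_zero,
        sub_zero]
  rw [locFourier_eq]
  simp_rw [locFourier_eq]
  rw [integral_congr_ae (ae_of_all _ hpt), integral_sub, integral_neg, integral_smul, integral_smul,
    integral_finsetSum]
  · congr 3
    refine Finset.sum_congr rfl fun α _ => ?_
    rw [integral_finsetSum _ fun β _ => hDA α β]
    refine Finset.sum_congr rfl fun β _ => ?_
    exact (mApplyCLM (A α β t)).integral_comp_comm (hD α β)
  · exact fun α _ => integrable_finsetSum _ fun β _ => hDA α β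
  · exact ((integrable_finsetSum _ fun α _ => integrable_finsetSum _ fun β _ => hDA α β).smul
      ((-1 : ℂ) ^ m)).neg
  · exact (hint _ hv.smooth.continuous).smul (lam : ℂ)

lemma LegendreHadamard.le_re_sum (h : LegendreHadamard d m l δ fun α β z => A α β z.1) (t : ℝ)
    (ξ : Esp d) (f : Fin l → ℂ) :
    δ * (2 * Real.pi * ‖ξ‖) ^ (2 * m) * ∑ i, Complex.normSq (f i) ≤
      (∑ i, (starRingEnd ℂ) (f i) * ∑ α ∈ MSetEq d m, ∑ β ∈ MSetEq d m,
        (((∏ i, (2 * Real.pi * ξ i) ^ α i) * ∏ i, (2 * Real.pi * ξ i) ^ β i : ℝ) : ℂ) *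
          mApply (A α β t) f i).re := by
  have h1 := h (t, 0) (fun i => 2 * Real.pi * ξ i) fun i => (starRingEnd ℂ) (f i)
  have h2 : ∑ i, (2 * Real.pi * ξ i) ^ 2 = (2 * Real.pi * ‖ξ‖) ^ 2 := by
    rw [mul_pow, EuclideanSpace.real_norm_sq_eq, Finset.mul_sum]
    exact Finset.sum_congr rfl fun i _ => by ring
  rw [h2, ← pow_mul] at h1
  simp only [Complex.normSq_conj, Complex.conj_conj] at h1
  refine h1.trans (le_of_eq (congrArg Complex.re ?_))
  simp only [Finset.mul_sum, mApply]
  rw [Finset.sum_comm]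
  conv_rhs => rw [Finset.sum_comm]
  conv_lhs => rw [Finset.sum_comm]
  refine Finset.sum_congr rfl fun α _ => ?_
  rw [Finset.sum_comm]
  refine Finset.sum_congr rfl fun β _ => Finset.sum_congr rfl fun i _ =>
    Finset.sum_congr rfl fun j _ => ?_
  ring

lemma norm_le_sqrt_sum_normSq (f : Fin l → ℂ) : ‖f‖ ≤ √(∑ i, Complex.normSq (f i)) := by
  refine (pi_norm_le_iff_of_nonneg (Real.sqrt_nonneg _)).2 fun i => ?_
  rw [Complex.norm_def]
  exact Real.sqrt_le_sqrt (Finset.single_le_sum (f := fun i => Complex.normSq (f i))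
    (fun i _ => Complex.normSq_nonneg _) (Finset.mem_univ i))

lemma sqrt_sum_normSq_le (f : Fin l → ℂ) : √(∑ i, Complex.normSq (f i)) ≤ l * ‖f‖ := by
  refine Real.sqrt_le_iff.2 ⟨by positivity, ?_⟩
  calc ∑ i, Complex.normSq (f i) ≤ ∑ _i : Fin l, ‖f‖ ^ 2 := Finset.sum_le_sum fun i _ => by
        rw [Complex.normSq_eq_norm_sq]
        exact pow_le_pow_left₀ (norm_nonneg _) (norm_le_pi_norm f i) 2
    _ = l * ‖f‖ ^ 2 := by simp
    _ ≤ (l * ‖f‖) ^ 2 := by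
        rw [mul_pow]
        refine mul_le_mul_of_nonneg_right ?_ (by positivity)
        exact_mod_cast Nat.le_self_pow two_ne_zero l

/-- The total size of the symbol defects of the leading derivatives. -/
def totalDefect {d l : ℕ} (m : ℕ) (ζ : Esp d → ℝ) (v : Pt d → Fin l → ℂ) (t : ℝ) (ξ : Esp d) : ℝ :=
  ∑ α ∈ MSetEq d m, ∑ β ∈ MSetEq d m, ‖symbolDefect ζ v (mIdxList d (α + β)) t ξ‖

lemma totalDefect_nonneg (t : ℝ) (ξ : Esp d) : 0 ≤ totalDefect m ζ v t ξ :=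
  Finset.sum_nonneg fun _ _ => Finset.sum_nonneg fun _ _ => norm_nonneg _

lemma continuous_totalDefect (hζ : IsCutoff d ζ) (hv : ContDiff ℝ ∞ v) (ξ : Esp d) :
    Continuous fun t => totalDefect m ζ v t ξ :=
  continuous_finsetSum _ fun _ _ => continuous_finsetSum _ fun _ _ =>
    (continuous_symbolDefect hζ hv _ ξ).norm

lemma re_sum_conj_mul_le (f g : Fin l → ℂ) :
    (∑ i, (starRingEnd ℂ) (f i) * g i).re ≤ √(∑ i, Complex.normSq (f i)) * (l * ‖g‖) := by
  refine (Complex.re_le_norm _).trans ((norm_sum_le _ _).trans ?_)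
  calc ∑ i, ‖(starRingEnd ℂ) (f i) * g i‖
      ≤ ∑ _i : Fin l, √(∑ i, Complex.normSq (f i)) * ‖g‖ := Finset.sum_le_sum fun i _ => by
        rw [norm_mul, RCLike.norm_conj]
        exact mul_le_mul ((norm_le_pi_norm f i).trans (norm_le_sqrt_sum_normSq f))
          (norm_le_pi_norm g i) (norm_nonneg _) (Real.sqrt_nonneg _)
    _ = √(∑ i, Complex.normSq (f i)) * (l * ‖g‖) := by
        simp
        ring

lemma re_sum_conj_mul_locFourier_tderiv_le (hδ : 0 < δ) (hv : IsLocalSolution d m l δ A lam v)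
    (hζ : IsCutoff d ζ) {t : ℝ} (ht : ∀ x ∈ Metric.ball (0 : Esp d) 4,
      tderiv d v (t, x) + ((-1 : ℝ) ^ m) • (∑ α ∈ MSetEq d m, ∑ β ∈ MSetEq d m,
        mApply (A α β t) (Dpar d (α + β) v (t, x))) + lam • v (t, x) = 0) (ξ : Esp d) :
    (∑ i, (starRingEnd ℂ) (locFourier ζ v t ξ i) * locFourier ζ (tderiv d v) t ξ i).re ≤
      -(δ * (2 * Real.pi * ‖ξ‖) ^ (2 * m) + lam) * ∑ i, Complex.normSq (locFourier ζ v t ξ i) +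
      √(∑ i, Complex.normSq (locFourier ζ v t ξ i)) *
        (l * (l * δ⁻¹ * totalDefect m ζ v t ξ)) := by
  set f := locFourier ζ v t ξ with hf
  set g : Fin l → ℂ := -(((-1 : ℂ) ^ m) • ∑ α ∈ MSetEq d m, ∑ β ∈ MSetEq d m,
    mApply (A α β t) (symbolDefect ζ v (mIdxList d (α + β)) t ξ)) with hg
  have hgn : ‖g‖ ≤ l * δ⁻¹ * totalDefect m ζ v t ξ := by
    rw [hg, norm_neg, norm_smul, norm_pow, norm_neg, norm_one, one_pow, one_mul, totalDefect]
    simp only [Finset.mul_sum]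
    exact norm_sum_le_of_le _ fun α hα => norm_sum_le_of_le _ fun β hβ =>
      norm_mApply_le (by positivity) (hv.bound α hα β hβ t) _
  have hsplit : ∀ i, locFourier ζ (tderiv d v) t ξ i = g i - (∑ α ∈ MSetEq d m, ∑ β ∈ MSetEq d m,
      (((∏ i, (2 * Real.pi * ξ i) ^ α i) * ∏ i, (2 * Real.pi * ξ i) ^ β i : ℝ) : ℂ) *
          mApply (A α β t) f i) - lam * f i := by
    intro i
    rw [locFourier_tderiv_eq hv hζ ht ξ]
    have hab : ∀ α ∈ MSetEq d m, ∀ β ∈ MSetEq d m,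
        mApply (A α β t) (locFourier ζ (Dpar d (α + β) v) t ξ) i =
          mApply (A α β t) (symbolDefect ζ v (mIdxList d (α + β)) t ξ) i + (-1) ^ m *
          ((((∏ i, (2 * Real.pi * ξ i) ^ α i) * ∏ i, (2 * Real.pi * ξ i) ^ β i : ℝ) : ℂ) *
          mApply (A α β t) f i) := by
      intro α hα β hβ
      have h1 : locFourier ζ (Dpar d (α + β) v) t ξ =
          symbolDefect ζ v (mIdxList d (α + β)) t ξ +
            ((mIdxList d (α + β)).map fun i => (2 * Real.pi * Complex.I * ξ i : ℂ)).prod • f := by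
        rw [symbolDefect, Dpar, sub_add_cancel]
      rw [h1, symbol_eq (deg_of_mem_MSetEq hα) (deg_of_mem_MSetEq hβ)]
      simp only [← mApplyCLM_apply, map_add, map_smul, Pi.add_apply, Pi.smul_apply, smul_eq_mul,
        mul_assoc]
    have hsq : ((-1 : ℂ) ^ m) * (-1) ^ m = 1 := by
      rw [← mul_pow]
      simp
    simp only [hg, Pi.sub_apply, Pi.neg_apply, Pi.smul_apply, Finset.sum_apply, smul_eq_mul]
    rw [Finset.sum_congr rfl fun α hα => Finset.sum_congr rfl fun β hβ => hab α hα β hβ]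
    simp only [Finset.sum_add_distrib, ← Finset.mul_sum]
    linear_combination (-(∑ α ∈ MSetEq d m, ∑ β ∈ MSetEq d m,
      (((∏ i, (2 * Real.pi * ξ i) ^ α i) * ∏ i, (2 * Real.pi * ξ i) ^ β i : ℝ) : ℂ) *
          mApply (A α β t) f i)) * hsq
  have hLH := hv.elliptic.le_re_sum t ξ f
  have hrem := re_sum_conj_mul_le f g
  have hself : (∑ i, (starRingEnd ℂ) (f i) * (lam * f i)).re =
      lam * ∑ i, Complex.normSq (f i) := by
    rw [Complex.re_sum, Finset.mul_sum]
    refine Finset.sum_congr rfl fun i _ => ?_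
    rw [mul_left_comm, ← Complex.normSq_eq_conj_mul_self, ← Complex.ofReal_mul, Complex.ofReal_re]
  simp only [hsplit, mul_sub, Finset.sum_sub_distrib, Complex.sub_re, hself]
  have hmul := mul_le_mul_of_nonneg_left (mul_le_mul_of_nonneg_left hgn (Nat.cast_nonneg l))
    (Real.sqrt_nonneg (∑ i, Complex.normSq (f i)))
  linarith

end Energy

/-- Smooth functions of time which vanish up to the time `a`. -/
def IsTimeCutoff (a : ℝ) (χ : ℝ → ℝ) : Prop :=
  ContDiff ℝ ∞ χ ∧ ∀ t ≤ a, χ t = 0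

lemma IsTimeCutoff.hasDerivAt {a : ℝ} {χ : ℝ → ℝ} (hχ : IsTimeCutoff a χ) (t : ℝ) :
    HasDerivAt χ (deriv χ t) t :=
  (hχ.1.differentiable (by simp) t).hasDerivAt

lemma IsTimeCutoff.deriv {a : ℝ} {χ : ℝ → ℝ} (hχ : IsTimeCutoff a χ) :
    IsTimeCutoff a (deriv χ) := by
  refine ⟨(contDiff_infty_iff_deriv.1 hχ.1).2, fun t ht => ?_⟩
  refine (uniqueDiffWithinAt_Iic t).eq_deriv _ (hχ.hasDerivAt t).hasDerivWithinAt
    ((hasDerivWithinAt_const t (Set.Iic t) (0 : ℝ)).congr (fun s hs => hχ.2 s (hs.trans ht))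
      (hχ.2 t ht))

lemma le_of_ae_le_of_continuous {U : Set ℝ} (hU : IsOpen U) {f g : ℝ → ℝ} (hf : Continuous f)
    (hg : Continuous g) (h : ∀ᵐ t ∂volume.restrict U, f t ≤ g t) {t : ℝ} (ht : t ∈ U) :
    f t ≤ g t := by
  have h1 := Measure.eqOn_open_of_ae_eq (f := fun t => max (f t) (g t)) (g := g)
    (h.mono fun t h => max_eq_right h) hU (hf.max hg).continuousOn hg.continuousOn ht
  exact (le_max_left _ _).trans h1.le

section EnergyEstimate

variable {d m l : ℕ} {δ : ℝ} {A : (Fin d → ℕ) → (Fin d → ℕ) → ℝ → (Fin l → Fin l → ℂ)}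
  {lam : ℝ} {v : Pt d → Fin l → ℂ} {ζ : Esp d → ℝ} {χ : ℝ → ℝ}

lemma hasDerivAt_sum_normSq {f : ℝ → Fin l → ℂ} {f' : Fin l → ℂ} {t : ℝ}
    (hf : HasDerivAt f f' t) :
    HasDerivAt (fun s => ∑ i, Complex.normSq (f s i))
      (2 * (∑ i, (starRingEnd ℂ) (f t i) * f' i).re) t := by
  have h := HasDerivAt.fun_sum fun i (_ : i ∈ Finset.univ) => ((hasDerivAt_pi.1 hf) i).norm_sq
  simp only [Complex.normSq_eq_norm_sq]
  refine h.congr_deriv ?_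
  rw [Complex.re_sum, Finset.mul_sum]
  refine Finset.sum_congr rfl fun i _ => ?_
  rw [Complex.inner, mul_comm (f' i)]

lemma norm_locFourier_add_integral_le (hδ : 0 < δ) (hv : IsLocalSolution d m l δ A lam v)
    (hζ : IsCutoff d ζ) (hχ : IsTimeCutoff (-(4 : ℝ) ^ (2 * m)) χ) (ξ : Esp d) {t : ℝ}
    (ht : t ∈ Set.Icc (-(4 : ℝ) ^ (2 * m)) 0) :
    |χ t| * ‖locFourier ζ v t ξ‖ + (δ * (2 * Real.pi * ‖ξ‖) ^ (2 * m) + lam) *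
        ∫ s in (-(4 : ℝ) ^ (2 * m))..t, |χ s| * ‖locFourier ζ v s ξ‖ ≤
      ∫ s in (-(4 : ℝ) ^ (2 * m))..t, (|deriv χ s| * (l * ‖locFourier ζ v s ξ‖) +
        |χ s| * (l * (l * δ⁻¹ * totalDefect m ζ v s ξ))) := by
  set a : ℝ := -(4 : ℝ) ^ (2 * m) with ha
  set p : ℝ := δ * (2 * Real.pi * ‖ξ‖) ^ (2 * m) + lam with hp
  have hp0 : 0 ≤ p := add_nonneg (by positivity) hv.nonneg
  set S : ℝ → ℝ := fun s => ∑ i, Complex.normSq (locFourier ζ v s ξ i) with hS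
  have hS0 : ∀ s, 0 ≤ S s := fun s => Finset.sum_nonneg fun i _ => Complex.normSq_nonneg _
  set R : ℝ → ℝ := fun s => (∑ i, (starRingEnd ℂ) (locFourier ζ v s ξ i) *
    locFourier ζ (tderiv d v) s ξ i).re with hR
  set K : ℝ → ℝ := fun s => l * (l * δ⁻¹ * totalDefect m ζ v s ξ) with hK
  have hK0 : ∀ s, 0 ≤ K s := fun s => by
    have := totalDefect_nonneg (m := m) (ζ := ζ) (v := v) s ξ
    positivity
  have hFc := continuous_locFourier hζ hv.smooth.continuous ξ
  have hF'c := continuous_locFourier hζ hv.smooth.tderiv.continuous ξ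
  have hχc := hχ.1.continuous
  have hχ'c := hχ.deriv.1.continuous
  have hSd : ∀ s, HasDerivAt S (2 * R s) s := fun s =>
    hasDerivAt_sum_normSq (hasDerivAt_locFourier hζ hv.smooth s ξ)
  have hSc : Continuous S := continuous_iff_continuousAt.2 fun t => (hSd t).continuousAt
  have hRc : Continuous R := Complex.continuous_re.comp (continuous_finsetSum _ fun i _ =>
    (Complex.continuous_conj.comp ((continuous_apply i).comp hFc)).mul
      ((continuous_apply i).comp hF'c))
  have hKc : Continuous K :=
    continuous_const.mul (continuous_const.mul (continuous_totalDefect hζ hv.smooth ξ))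
  have hsqrt : ∀ s, √(χ s ^ 2 * S s) = |χ s| * √(S s) := fun s => by
    rw [Real.sqrt_mul (sq_nonneg _), Real.sqrt_sq_eq_abs]
  set k : ℝ → ℝ := fun s => |deriv χ s| * √(S s) + |χ s| * K s with hk
  have hkc : Continuous k := (hχ'c.abs.mul hSc.sqrt).add (hχc.abs.mul hKc)
  have hk0 : ∀ s, 0 ≤ k s := fun s =>
    add_nonneg (by positivity) (mul_nonneg (abs_nonneg _) (hK0 s))
  have hy : ∀ s, HasDerivAt (fun s => χ s ^ 2 * S s)
      (2 * χ s * deriv χ s * S s + χ s ^ 2 * (2 * R s)) s := fun s =>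
    (((hχ.hasDerivAt s).fun_pow 2).fun_mul (hSd s)).congr_deriv (by simp)
  have hineq : ∀ s ∈ Set.Ioo a 0, 2 * χ s * deriv χ s * S s + χ s ^ 2 * (2 * R s) ≤
      -2 * p * (χ s ^ 2 * S s) + 2 * √(χ s ^ 2 * S s) * k s := by
    intro s hs
    refine le_of_ae_le_of_continuous (U := Set.Ioo a 0)
      (f := fun s => 2 * χ s * deriv χ s * S s + χ s ^ 2 * (2 * R s))
      (g := fun s => -2 * p * (χ s ^ 2 * S s) + 2 * √(χ s ^ 2 * S s) * k s)
      isOpen_Ioo (by fun_prop) (by fun_prop) ?_ hs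
    filter_upwards [hv.eqn] with r hr
    have h1 : R r ≤ -p * S r + √(S r) * K r :=
      re_sum_conj_mul_locFourier_tderiv_le hδ hv hζ hr ξ
    have h2 := mul_le_mul_of_nonneg_left h1 (sq_nonneg (χ r))
    have h3 : χ r * deriv χ r * S r ≤ |χ r| * |deriv χ r| * S r := by
      rw [← abs_mul]
      exact mul_le_mul_of_nonneg_right (le_abs_self _) (hS0 r)
    have h4 : √(S r) * √(S r) = S r := Real.mul_self_sqrt (hS0 r)
    have h5 : |χ r| * |χ r| = χ r ^ 2 := by rw [← sq, sq_abs]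
    rw [hsqrt]
    have h6 : 2 * (|χ r| * √(S r)) * k r =
        2 * (|χ r| * |deriv χ r| * S r) + 2 * (χ r ^ 2 * (√(S r) * K r)) := by
      rw [hk, ← h5]
      linear_combination (2 * |χ r| * |deriv χ r|) * h4
    rw [h6]
    linarith
  have hmain := sqrt_add_integral_le hp0 hy (fun s => mul_nonneg (sq_nonneg _) (hS0 s))
    (by simp [hχ.2 a le_rfl]) hkc hk0 hineq ht
  simp only [hsqrt] at hmain
  have hle : ∀ s, |χ s| * ‖locFourier ζ v s ξ‖ ≤ |χ s| * √(S s) := fun s =>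
    mul_le_mul_of_nonneg_left (norm_le_sqrt_sum_normSq _) (abs_nonneg _)
  refine (add_le_add (hle t) (mul_le_mul_of_nonneg_left (intervalIntegral.integral_mono_on ht.1
    (Continuous.intervalIntegrable (by fun_prop) _ _)
    (Continuous.intervalIntegrable (by fun_prop) _ _) fun s _ => hle s) hp0)).trans
    (hmain.trans (intervalIntegral.integral_mono_on ht.1 (hkc.intervalIntegrable _ _)
      (((hχ'c.abs.mul (continuous_const.mul hFc.norm)).add
        (hχc.abs.mul hKc)).intervalIntegrable _ _) fun s _ => ?_))
  exact add_le_add (mul_le_mul_of_nonneg_left (sqrt_sum_normSq_le _) (abs_nonneg _)) le_rfl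

end EnergyEstimate

/-! ### Decay in the frequency -/

/-- The integral of `‖v‖` over `Q₄`. -/
def localMass {d l : ℕ} (m : ℕ) (v : Pt d → Fin l → ℂ) : ℝ :=
  ∫ z in (Set.Ioo (-(4 : ℝ) ^ (2 * m)) 0) ×ˢ Metric.ball (0 : Esp d) 4, ‖v z‖

lemma localMass_nonneg {d l : ℕ} (m : ℕ) (v : Pt d → Fin l → ℂ) : 0 ≤ localMass m v :=
  integral_nonneg fun _ => norm_nonneg _

/-- The localized Fourier transforms of solutions, integrated in time and weighted by `κ(λ)`, decay
like `|ξ|^{-s}`. -/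
def HasFreqDecay (d m l : ℕ) (δ : ℝ) (κ : ℝ → ℝ) (s : ℕ) : Prop :=
  ∀ χ ζ, IsTimeCutoff (-(4 : ℝ) ^ (2 * m)) χ → IsCutoff d ζ → ∃ C, 0 ≤ C ∧
    ∀ A lam v, IsLocalSolution d m l δ A lam v → ∀ ξ : Esp d,
      κ lam * (1 + ‖ξ‖) ^ s *
        (∫ t in (-(4 : ℝ) ^ (2 * m))..0, |χ t| * ‖locFourier ζ v t ξ‖) ≤ C * localMass m v

section Decay

variable {d m l : ℕ} {δ : ℝ} {κ : ℝ → ℝ}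

lemma neg_four_pow_nonpos (m : ℕ) : -(4 : ℝ) ^ (2 * m) ≤ 0 :=
  neg_nonpos.2 (by positivity)

lemma intervalIntegral_le_of_continuous_of_le {a b : ℝ} (hab : a ≤ b) {f g : ℝ → ℝ} (hf : Continuous f)
    (hg : Continuous g) (h : ∀ t, f t ≤ g t) : ∫ t in a..b, f t ≤ ∫ t in a..b, g t :=
  intervalIntegral.integral_mono_on hab (hf.intervalIntegrable _ _) (hg.intervalIntegrable _ _)
    fun t _ => h t

lemma symbolDefect_cons {v : Pt d → Fin l → ℂ} {ζ : Esp d → ℝ} (hζ : IsCutoff d ζ)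
    (hv : ContDiff ℝ ∞ v) (i : Fin d) (L : List (Fin d)) (t : ℝ) (ξ : Esp d) :
    symbolDefect ζ v (i :: L) t ξ =
      (2 * Real.pi * Complex.I * ξ i : ℂ) • symbolDefect ζ v L t ξ -
      (symbolDefect (fun x => fderiv ℝ ζ x (EuclideanSpace.single i 1)) v L t ξ +
        (L.map fun i => (2 * Real.pi * Complex.I * ξ i : ℂ)).prod •
          locFourier (fun x => fderiv ℝ ζ x (EuclideanSpace.single i 1)) v t ξ) := by
  have h := locFourier_sderiv hζ (hv.sderivIter L) i t ξ
  simp only [symbolDefect, List.map_cons, List.prod_cons, smul_sub, smul_smul, sub_add_cancel]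
  rw [show sderivIter d (i :: L) v = sderiv d i (sderivIter d L v) from rfl, h]
  abel

lemma norm_two_pi_I_mul_le (ξ : Esp d) (i : Fin d) :
    ‖(2 * Real.pi * Complex.I * ξ i : ℂ)‖ ≤ 2 * Real.pi * (1 + ‖ξ‖) := by
  have h1 : ‖(ξ i : ℂ)‖ ≤ 1 + ‖ξ‖ := by
    rw [Complex.norm_real]
    linarith [PiLp.norm_apply_le ξ i]
  have h2 : ‖(2 * Real.pi * Complex.I : ℂ)‖ = 2 * Real.pi := by
    simp [abs_of_pos Real.pi_pos]
  rw [norm_mul, h2]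
  gcongr

lemma norm_prod_two_pi_I_mul_le (ξ : Esp d) (L : List (Fin d)) :
    ‖(L.map fun i => (2 * Real.pi * Complex.I * ξ i : ℂ)).prod‖ ≤
      (2 * Real.pi * (1 + ‖ξ‖)) ^ L.length := by
  induction L with
  | nil => simp
  | cons i L ih =>
    rw [List.map_cons, List.prod_cons, norm_mul, List.length_cons, pow_succ']
    exact mul_le_mul (norm_two_pi_I_mul_le ξ i) ih (norm_nonneg _) (by positivity)

lemma HasFreqDecay.symbolDefect {s : ℕ} (hκ : ∀ x, 0 ≤ x → 0 ≤ κ x)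
    (h : HasFreqDecay d m l δ κ s) (L : List (Fin d)) {χ : ℝ → ℝ} {ζ : Esp d → ℝ}
    (hχ : IsTimeCutoff (-(4 : ℝ) ^ (2 * m)) χ) (hζ : IsCutoff d ζ) :
    ∃ C, 0 ≤ C ∧ ∀ A lam v, IsLocalSolution d m l δ A lam v → ∀ ξ : Esp d,
      κ lam * (1 + ‖ξ‖) ^ (s + 1) *
        (∫ t in (-(4 : ℝ) ^ (2 * m))..0, |χ t| * ‖symbolDefect ζ v L t ξ‖) ≤
        C * (1 + ‖ξ‖) ^ L.length * localMass m v := by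
  induction L generalizing ζ with
  | nil =>
    refine ⟨0, le_rfl, fun A lam v _ ξ => ?_⟩
    simp [_root_.symbolDefect, sderivIter]
  | cons i L ih =>
    obtain ⟨C₁, hC₁, h₁⟩ := ih hζ
    obtain ⟨C₂, hC₂, h₂⟩ := ih (hζ.partialDeriv i)
    obtain ⟨C₃, hC₃, h₃⟩ := h χ _ hχ (hζ.partialDeriv i)
    refine ⟨2 * Real.pi * C₁ + C₂ + (2 * Real.pi) ^ L.length * C₃, by positivity,
      fun A lam v hv ξ => ?_⟩
    specialize h₁ A lam v hv ξ
    specialize h₂ A lam v hv ξ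
    specialize h₃ A lam v hv ξ
    have hχc := hχ.1.continuous.abs
    have c₁ := hχc.fun_mul (continuous_symbolDefect hζ hv.smooth L ξ).norm
    have c₂ := hχc.fun_mul (continuous_symbolDefect (hζ.partialDeriv i) hv.smooth L ξ).norm
    have c₃ := hχc.fun_mul (continuous_locFourier (hζ.partialDeriv i) hv.smooth.continuous ξ).norm
    have c := hχc.fun_mul (continuous_symbolDefect hζ hv.smooth (i :: L) ξ).norm
    set X := 1 + ‖ξ‖ with hX
    have hX1 : 1 ≤ X := by linarith [norm_nonneg ξ]
    set M := localMass m v with hM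
    have hM0 : 0 ≤ M := localMass_nonneg m v
    have hle : (∫ t in (-(4 : ℝ) ^ (2 * m))..0, |χ t| * ‖_root_.symbolDefect ζ v (i :: L) t ξ‖) ≤
        2 * Real.pi * X * (∫ t in (-(4 : ℝ) ^ (2 * m))..0, |χ t| * ‖_root_.symbolDefect ζ v L t ξ‖) +
        ((∫ t in (-(4 : ℝ) ^ (2 * m))..0, |χ t| * ‖_root_.symbolDefect
          (fun x => fderiv ℝ ζ x (EuclideanSpace.single i 1)) v L t ξ‖) +
        (2 * Real.pi * X) ^ L.length * (∫ t in (-(4 : ℝ) ^ (2 * m))..0, |χ t| * ‖locFourier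
          (fun x => fderiv ℝ ζ x (EuclideanSpace.single i 1)) v t ξ‖)) := by
      rw [← intervalIntegral.integral_const_mul, ← intervalIntegral.integral_const_mul,
        ← intervalIntegral.integral_add (c₂.intervalIntegrable _ _)
          ((continuous_const.fun_mul c₃).intervalIntegrable _ _),
        ← intervalIntegral.integral_add ((continuous_const.fun_mul c₁).intervalIntegrable _ _)
          ((c₂.fun_add (continuous_const.fun_mul c₃)).intervalIntegrable _ _)]
      refine intervalIntegral_le_of_continuous_of_le (neg_four_pow_nonpos m) c
        ((continuous_const.fun_mul c₁).fun_add (c₂.fun_add (continuous_const.fun_mul c₃))) fun t => ?_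
      have hn : ‖_root_.symbolDefect ζ v (i :: L) t ξ‖ ≤
          2 * Real.pi * X * ‖_root_.symbolDefect ζ v L t ξ‖ + (‖_root_.symbolDefect
          (fun x => fderiv ℝ ζ x (EuclideanSpace.single i 1)) v L t ξ‖ +
          (2 * Real.pi * X) ^ L.length * ‖locFourier
          (fun x => fderiv ℝ ζ x (EuclideanSpace.single i 1)) v t ξ‖) := by
        rw [symbolDefect_cons hζ hv.smooth]
        refine (norm_sub_le _ _).trans (add_le_add ?_ ((norm_add_le _ _).trans
          (add_le_add le_rfl ?_)))
        · rw [norm_smul]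
          exact mul_le_mul_of_nonneg_right (norm_two_pi_I_mul_le ξ i) (norm_nonneg _)
        · rw [norm_smul]
          exact mul_le_mul_of_nonneg_right (norm_prod_two_pi_I_mul_le ξ L) (norm_nonneg _)
      exact (mul_le_mul_of_nonneg_left hn (abs_nonneg (χ t))).trans (le_of_eq (by ring))
    have hκX : 0 ≤ κ lam * X ^ (s + 1) := mul_nonneg (hκ _ hv.nonneg) (by positivity)
    refine (mul_le_mul_of_nonneg_left hle hκX).trans ?_
    have e₁ := mul_le_mul_of_nonneg_left h₁ (show 0 ≤ 2 * Real.pi * X by positivity)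
    have e₂ : C₂ * X ^ L.length * M ≤ C₂ * X ^ (L.length + 1) * M := by
      gcongr
      exact Nat.le_succ _
    have e₃ := mul_le_mul_of_nonneg_left h₃ (show 0 ≤ (2 * Real.pi * X) ^ L.length * X by positivity)
    rw [mul_pow] at e₃ ⊢
    rw [List.length_cons]
    simp only [pow_succ] at *
    linarith

lemma HasFreqDecay.energy {s : ℕ} (hm : 1 ≤ m) (hδ : δ ∈ Set.Ioo (0 : ℝ) 1)
    (hκ : ∀ x, 0 ≤ x → 0 ≤ κ x) (h : HasFreqDecay d m l δ κ s) {χ : ℝ → ℝ} {ζ : Esp d → ℝ}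
    (hχ : IsTimeCutoff (-(4 : ℝ) ^ (2 * m)) χ) (hζ : IsCutoff d ζ) :
    ∃ C, 0 ≤ C ∧ ∀ A lam v, IsLocalSolution d m l δ A lam v → ∀ ξ : Esp d,
      (∀ t ∈ Set.Icc (-(4 : ℝ) ^ (2 * m)) 0,
        κ lam * (1 + ‖ξ‖) ^ (s + 1) * (|χ t| * ‖locFourier ζ v t ξ‖) ≤
          C * (1 + ‖ξ‖) ^ (2 * m) * localMass m v) ∧
      κ lam * (1 + ‖ξ‖) ^ (s + 1) * ((‖ξ‖ ^ (2 * m) + lam) *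
        ∫ t in (-(4 : ℝ) ^ (2 * m))..0, |χ t| * ‖locFourier ζ v t ξ‖) ≤
          C * (1 + ‖ξ‖) ^ (2 * m) * localMass m v := by
  obtain ⟨C₁, hC₁, h₁⟩ := h _ ζ hχ.deriv hζ
  choose C₂ hC₂ h₂ using fun L => h.symbolDefect hκ L hχ hζ
  have hδ0 : 0 < δ := hδ.1
  set C : ℝ := l * C₁ + l * (l * δ⁻¹ * ∑ α ∈ MSetEq d m, ∑ β ∈ MSetEq d m,
    C₂ (mIdxList d (α + β))) with hC
  have hsum0 : 0 ≤ ∑ α ∈ MSetEq d m, ∑ β ∈ MSetEq d m, C₂ (mIdxList d (α + β)) :=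
    Finset.sum_nonneg fun _ _ => Finset.sum_nonneg fun _ _ => hC₂ _
  have hC0 : 0 ≤ C := by positivity
  refine ⟨δ⁻¹ * C, by positivity, fun A lam v hv ξ => ?_⟩
  have hE := fun t => norm_locFourier_add_integral_le hδ0 hv hζ hχ ξ (t := t)
  have ha := neg_four_pow_nonpos m
  specialize h₁ A lam v hv ξ
  replace h₂ := fun L => h₂ L A lam v hv ξ
  have hχc := hχ.1.continuous.abs
  have c₁ := hχ.deriv.1.continuous.abs.fun_mul
    (continuous_locFourier hζ hv.smooth.continuous ξ).norm
  have c₂ := fun L => hχc.fun_mul (continuous_symbolDefect hζ hv.smooth L ξ).norm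
  have c₃ := hχc.fun_mul (continuous_totalDefect (m := m) hζ hv.smooth ξ)
  have c₀ := hχc.fun_mul (continuous_locFourier hζ hv.smooth.continuous ξ).norm
  have hlam := hv.nonneg
  set a : ℝ := -(4 : ℝ) ^ (2 * m) with ha'
  set X := 1 + ‖ξ‖ with hX
  have hX1 : 1 ≤ X := by linarith [norm_nonneg ξ]
  set M := localMass m v with hM
  have hM0 : 0 ≤ M := localMass_nonneg m v
  have hκX : 0 ≤ κ lam * X ^ (s + 1) := mul_nonneg (hκ _ hlam) (by positivity)
  set k : ℝ → ℝ := fun s => |deriv χ s| * (l * ‖locFourier ζ v s ξ‖) +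
    |χ s| * (l * (l * δ⁻¹ * totalDefect m ζ v s ξ)) with hk
  have hk' : k = fun s => l * (|deriv χ s| * ‖locFourier ζ v s ξ‖) +
      l * (l * δ⁻¹) * (|χ s| * totalDefect m ζ v s ξ) := by
    funext s
    rw [hk]
    ring
  have hkc : Continuous k := by
    rw [hk']
    exact (continuous_const.fun_mul c₁).fun_add (continuous_const.fun_mul c₃)
  have hk0 : ∀ s, 0 ≤ k s := fun s => by
    have := totalDefect_nonneg (m := m) (ζ := ζ) (v := v) s ξ
    positivity
  have htot : κ lam * X ^ (s + 1) * (∫ t in a..0, |χ t| * totalDefect m ζ v t ξ) ≤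
      (∑ α ∈ MSetEq d m, ∑ β ∈ MSetEq d m, C₂ (mIdxList d (α + β))) * X ^ (2 * m) * M := by
    simp only [totalDefect, Finset.mul_sum]
    rw [intervalIntegral.integral_finsetSum fun α _ =>
      (continuous_finsetSum _ fun β _ => c₂ _).intervalIntegrable _ _]
    simp only [Finset.mul_sum, Finset.sum_mul]
    refine Finset.sum_le_sum fun α hα => ?_
    rw [intervalIntegral.integral_finsetSum fun β _ => (c₂ _).intervalIntegrable _ _]
    simp only [Finset.mul_sum]
    refine Finset.sum_le_sum fun β hβ => ?_
    have hlen : (mIdxList d (α + β)).length = 2 * m := by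
      have : deg (α + β) = deg α + deg β := Finset.sum_add_distrib
      rw [length_mIdxList, this, deg_of_mem_MSetEq hα, deg_of_mem_MSetEq hβ, two_mul]
    rw [← hlen]
    exact h₂ _
  have hkint : κ lam * X ^ (s + 1) * (∫ t in a..0, k t) ≤ C * X ^ (2 * m) * M := by
    rw [hk', intervalIntegral.integral_add ((continuous_const.fun_mul c₁).intervalIntegrable _ _)
      ((continuous_const.fun_mul c₃).intervalIntegrable _ _), intervalIntegral.integral_const_mul,
      intervalIntegral.integral_const_mul]
    have e₁ := mul_le_mul_of_nonneg_left h₁ (show 0 ≤ l * X by positivity)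
    have e₂ : l * X * (C₁ * M) ≤ l * X ^ (2 * m) * (C₁ * M) := by
      gcongr
      exact le_self_pow₀ hX1 (by lia)
    have e₃ := mul_le_mul_of_nonneg_left htot (show 0 ≤ l * (l * δ⁻¹) by positivity)
    simp only [pow_succ X s] at *
    rw [hC]
    linarith
  have hone : C * X ^ (2 * m) * M ≤ δ⁻¹ * C * X ^ (2 * m) * M := by
    have : 1 ≤ δ⁻¹ := (one_le_inv₀ hδ0).2 hδ.2.le
    have h0 : 0 ≤ C * X ^ (2 * m) * M := by positivity
    nlinarith
  have hI0 : ∀ t ∈ Set.Icc a 0, 0 ≤ ∫ s in a..t, |χ s| * ‖locFourier ζ v s ξ‖ := fun t ht =>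
    intervalIntegral.integral_nonneg ht.1 fun _ _ => by positivity
  refine ⟨fun t ht => (mul_le_mul_of_nonneg_left ?_ hκX).trans (hkint.trans hone), ?_⟩
  · have h3 : (∫ s in a..t, k s) ≤ ∫ s in a..0, k s :=
      intervalIntegral.integral_mono_interval le_rfl ht.1 ht.2 (ae_of_all _ hk0)
        (hkc.intervalIntegrable _ _)
    have h4 : 0 ≤ (δ * (2 * Real.pi * ‖ξ‖) ^ (2 * m) + lam) *
        ∫ s in a..t, |χ s| * ‖locFourier ζ v s ξ‖ :=
      mul_nonneg (by positivity) (hI0 t ht)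
    linarith [hE t ht]
  · have h0 := Set.right_mem_Icc.2 ha
    have hp : δ * (‖ξ‖ ^ (2 * m) + lam) ≤ δ * (2 * Real.pi * ‖ξ‖) ^ (2 * m) + lam := by
      rw [mul_add]
      refine add_le_add (mul_le_mul_of_nonneg_left (pow_le_pow_left₀ (norm_nonneg _) ?_ _) hδ0.le)
        (mul_le_of_le_one_left hlam hδ.2.le)
      exact le_mul_of_one_le_left (norm_nonneg _) (by linarith [Real.pi_gt_three])
    have h3 : δ * ((‖ξ‖ ^ (2 * m) + lam) * ∫ s in a..0, |χ s| * ‖locFourier ζ v s ξ‖) ≤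
        ∫ s in a..0, k s := by
      have h5 := mul_le_mul_of_nonneg_right hp (hI0 0 h0)
      have h6 : 0 ≤ |χ 0| * ‖locFourier ζ v 0 ξ‖ := by positivity
      linarith [hE 0 h0]
    have h7 := (mul_le_mul_of_nonneg_left h3 hκX).trans hkint
    have h8 := mul_le_mul_of_nonneg_left h7 (inv_nonneg.2 hδ0.le)
    refine le_trans (le_of_eq ?_) (h8.trans (le_of_eq (by ring)))
    field_simp

lemma integral_integral_norm_eq {v : Pt d → Fin l → ℂ} (hv : Continuous v) :
    ∫ t in (-(4 : ℝ) ^ (2 * m))..0, ∫ x in Metric.ball (0 : Esp d) 4, ‖v (t, x)‖ =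
      localMass m v := by
  rw [localMass, intervalIntegral.integral_of_le (neg_four_pow_nonpos m),
    integral_Ioc_eq_integral_Ioo, Measure.volume_eq_prod, setIntegral_prod]
  rw [← Measure.volume_eq_prod]
  exact (hv.norm.continuousOn.integrableOn_compact (isCompact_Icc.prod
    (isCompact_closedBall (0 : Esp d) 4))).mono_set
      (Set.prod_mono Set.Ioo_subset_Icc_self Metric.ball_subset_closedBall)

lemma hasFreqDecay_one_zero : HasFreqDecay d m l δ (fun _ => 1) 0 := by
  intro χ ζ hχ hζ
  obtain ⟨C, hC0, hC⟩ := hζ.exists_bound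
  obtain ⟨D, hD⟩ := (isCompact_Icc (a := -(4 : ℝ) ^ (2 * m)) (b := 0)).exists_bound_of_continuousOn
    hχ.1.continuous.continuousOn
  have hD0 : 0 ≤ D := (norm_nonneg _).trans (hD 0 (Set.right_mem_Icc.2 (neg_four_pow_nonpos m)))
  refine ⟨D * C, by positivity, fun A lam v hv ξ => ?_⟩
  rw [pow_zero, one_mul, one_mul, ← integral_integral_norm_eq hv.smooth.continuous,
    ← intervalIntegral.integral_const_mul]
  have hvc := hv.smooth.continuous
  refine intervalIntegral.integral_mono_on (neg_four_pow_nonpos m)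
    ((hχ.1.continuous.abs.fun_mul (continuous_locFourier hζ hvc ξ).norm).intervalIntegrable _ _) ?_
    fun t ht => ?_
  · rw [intervalIntegrable_iff_integrableOn_Ioo_of_le (neg_four_pow_nonpos m)]
    have hi : Integrable (fun z : Pt d => ‖v z‖)
        ((volume.restrict (Set.Ioo (-(4 : ℝ) ^ (2 * m)) 0)).prod
          (volume.restrict (Metric.ball (0 : Esp d) 4))) := by
      rw [Measure.prod_restrict, ← Measure.volume_eq_prod]
      exact (hvc.norm.continuousOn.integrableOn_compact (isCompact_Icc.prod
        (isCompact_closedBall (0 : Esp d) 4))).mono_set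
          (Set.prod_mono Set.Ioo_subset_Icc_self Metric.ball_subset_closedBall)
    exact hi.integral_prod_left.const_mul (D * C)
  · rw [mul_assoc]
    exact mul_le_mul (hD t ht) (norm_locFourier_le hζ hC hv.smooth t ξ) (norm_nonneg _) hD0

lemma HasFreqDecay.succ {s : ℕ} (hm : 1 ≤ m) (hδ : δ ∈ Set.Ioo (0 : ℝ) 1)
    (hκ : ∀ x, 0 ≤ x → 0 ≤ κ x) (h : HasFreqDecay d m l δ κ s) :
    HasFreqDecay d m l δ κ (s + 1) := by
  intro χ ζ hχ hζ
  obtain ⟨C, hC0, hC⟩ := h.energy hm hδ hκ hχ hζ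
  refine ⟨2 ^ (2 * m) * (4 ^ (2 * m) * C + C), by positivity, fun A lam v hv ξ => ?_⟩
  obtain ⟨h₁, h₂⟩ := hC A lam v hv ξ
  have c₀ := hχ.1.continuous.abs.fun_mul (continuous_locFourier hζ hv.smooth.continuous ξ).norm
  have ha := neg_four_pow_nonpos m
  set X := 1 + ‖ξ‖ with hX
  have hX1 : 1 ≤ X := by linarith [norm_nonneg ξ]
  set M := localMass m v with hM
  have hM0 : 0 ≤ M := localMass_nonneg m v
  set I := ∫ t in (-(4 : ℝ) ^ (2 * m))..0, |χ t| * ‖locFourier ζ v t ξ‖ with hI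
  have hI0 : 0 ≤ I := intervalIntegral.integral_nonneg ha fun _ _ => by positivity
  have hκX : 0 ≤ κ lam * X ^ (s + 1) := mul_nonneg (hκ _ hv.nonneg) (by positivity)
  have h₃ : κ lam * X ^ (s + 1) * I ≤ 4 ^ (2 * m) * (C * X ^ (2 * m) * M) := by
    rw [hI, ← intervalIntegral.integral_const_mul]
    refine (intervalIntegral.integral_mono_on ha ((continuous_const.fun_mul c₀).intervalIntegrable _ _)
      intervalIntegrable_const h₁).trans (le_of_eq ?_)
    rw [intervalIntegral.integral_const, zero_sub, neg_neg, smul_eq_mul]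
  have h₄ : κ lam * X ^ (s + 1) * (‖ξ‖ ^ (2 * m) * I) ≤ C * X ^ (2 * m) * M := by
    refine le_trans (mul_le_mul_of_nonneg_left (mul_le_mul_of_nonneg_right ?_ hI0) hκX) h₂
    linarith [hv.nonneg]
  have h₅ : X ^ (2 * m) ≤ 2 ^ (2 * m) * (1 + ‖ξ‖ ^ (2 * m)) := by
    refine (add_pow_le zero_le_one (norm_nonneg ξ) (2 * m)).trans ?_
    rw [one_pow]
    gcongr
    · norm_num
    · lia
  have hXp : 0 < X ^ (2 * m) := by positivity
  refine le_of_mul_le_mul_left ?_ hXp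
  have h₆ := mul_le_mul_of_nonneg_right h₅ (mul_nonneg hκX hI0)
  have h₇ := mul_le_mul_of_nonneg_left (add_le_add h₃ h₄) (show (0 : ℝ) ≤ 2 ^ (2 * m) by positivity)
  linarith

lemma HasFreqDecay.all (hm : 1 ≤ m) (hδ : δ ∈ Set.Ioo (0 : ℝ) 1)
    (hκ : ∀ x, 0 ≤ x → 0 ≤ κ x) (h : HasFreqDecay d m l δ κ 0) (s : ℕ) :
    HasFreqDecay d m l δ κ s := by
  induction s with
  | zero => exact h
  | succ s ih => exact ih.succ hm hδ hκ

lemma hasFreqDecay_one (hm : 1 ≤ m) (hδ : δ ∈ Set.Ioo (0 : ℝ) 1) (s : ℕ) :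
    HasFreqDecay d m l δ (fun _ => 1) s :=
  hasFreqDecay_one_zero.all hm hδ (fun _ _ => zero_le_one) s

lemma hasFreqDecay_id (hm : 1 ≤ m) (hδ : δ ∈ Set.Ioo (0 : ℝ) 1) (s : ℕ) :
    HasFreqDecay d m l δ id s := by
  refine HasFreqDecay.all hm hδ (fun _ h => h) (fun χ ζ hχ hζ => ?_) s
  obtain ⟨C, hC0, hC⟩ := (hasFreqDecay_one (d := d) (l := l) hm hδ (2 * m - 1)).energy hm hδ
    (fun _ _ => zero_le_one) hχ hζ
  refine ⟨C, hC0, fun A lam v hv ξ => ?_⟩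
  have h₂ := (hC A lam v hv ξ).2
  have hI0 : 0 ≤ ∫ t in (-(4 : ℝ) ^ (2 * m))..0, |χ t| * ‖locFourier ζ v t ξ‖ :=
    intervalIntegral.integral_nonneg (neg_four_pow_nonpos m) fun _ _ => by positivity
  rw [show 2 * m - 1 + 1 = 2 * m by lia] at h₂
  have hXp : 0 < (1 + ‖ξ‖) ^ (2 * m) := by positivity
  refine le_of_mul_le_mul_left ?_ hXp
  have h₃ := mul_le_mul_of_nonneg_left (mul_le_mul_of_nonneg_right
    (show lam ≤ ‖ξ‖ ^ (2 * m) + lam by linarith [pow_nonneg (norm_nonneg ξ) (2 * m)]) hI0) hXp.le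
  simp only [pow_zero]
  linarith

lemma exists_norm_locFourier_le (hm : 1 ≤ m) (hδ : δ ∈ Set.Ioo (0 : ℝ) 1)
    (hκ : ∀ x, 0 ≤ x → 0 ≤ κ x) (h : ∀ s, HasFreqDecay d m l δ κ s) (s : ℕ) {χ : ℝ → ℝ}
    {ζ : Esp d → ℝ} (hχ : IsTimeCutoff (-(4 : ℝ) ^ (2 * m)) χ) (hζ : IsCutoff d ζ) :
    ∃ C, 0 ≤ C ∧ ∀ A lam v, IsLocalSolution d m l δ A lam v → ∀ ξ : Esp d,
      ∀ t ∈ Set.Icc (-(4 : ℝ) ^ (2 * m)) 0,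
        κ lam * (1 + ‖ξ‖) ^ s * (|χ t| * ‖locFourier ζ v t ξ‖) ≤ C * localMass m v := by
  obtain ⟨C, hC0, hC⟩ := (h (s + (2 * m - 1))).energy hm hδ hκ hχ hζ
  refine ⟨C, hC0, fun A lam v hv ξ t ht => ?_⟩
  have h₁ := (hC A lam v hv ξ).1 t ht
  rw [show s + (2 * m - 1) + 1 = s + 2 * m by lia, pow_add] at h₁
  refine le_of_mul_le_mul_left ?_ (show 0 < (1 + ‖ξ‖) ^ (2 * m) by positivity)
  linarith

end Decay

/-! ### Pointwise bounds -/

section Pointwise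

variable {d m l : ℕ} {δ : ℝ} {κ : ℝ → ℝ}

lemma norm_le_of_fourier_decay {g : Esp d → Fin l → ℂ} (hg : Continuous g) (hgi : Integrable g)
    {B : ℝ} (hB : ∀ ξ, (1 + ‖ξ‖) ^ (d + 1) * ‖𝓕 g ξ‖ ≤ B) (x : Esp d) :
    ‖g x‖ ≤ B * ∫ ξ : Esp d, (1 + ‖ξ‖) ^ (-(d + 1 : ℝ)) := by
  have hw : Integrable fun ξ : Esp d => (1 + ‖ξ‖) ^ (-(d + 1 : ℝ)) :=
    integrable_one_add_norm (by simp)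
  have hbound : ∀ ξ, ‖𝓕 g ξ‖ ≤ B * (1 + ‖ξ‖) ^ (-(d + 1 : ℝ)) := fun ξ => by
    have hX : 0 < 1 + ‖ξ‖ := by positivity
    rw [Real.rpow_neg hX.le, ← div_eq_mul_inv, le_div_iff₀ (by positivity), mul_comm]
    exact_mod_cast hB ξ
  have hcont : Continuous (𝓕 g) :=
    VectorFourier.fourierIntegral_continuous Real.continuous_fourierChar
      (innerSL ℝ (E := Esp d)).continuous₂ hgi
  have hFi : Integrable (𝓕 g) :=
    (hw.const_mul B).mono' hcont.aestronglyMeasurable (ae_of_all _ hbound)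
  rw [← congrFun (hg.fourierInv_fourier_eq hgi hFi) x, Real.fourierInv_eq', ← integral_const_mul]
  refine norm_integral_le_of_norm_le (hw.const_mul B) (ae_of_all _ fun ξ => ?_)
  rw [norm_smul, Complex.norm_exp_ofReal_mul_I, one_mul]
  exact hbound ξ

lemma exists_norm_locFourier_sderivIter_le (hm : 1 ≤ m) (hδ : δ ∈ Set.Ioo (0 : ℝ) 1)
    (hκ : ∀ x, 0 ≤ x → 0 ≤ κ x) (h : ∀ s, HasFreqDecay d m l δ κ s) (L : List (Fin d)) (s : ℕ)
    {ζ : Esp d → ℝ} (hζ : IsCutoff d ζ) :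
    ∃ C, 0 ≤ C ∧ ∀ A lam v, IsLocalSolution d m l δ A lam v → ∀ ξ : Esp d,
      ∀ t ∈ Set.Icc (-1 : ℝ) 0,
        κ lam * (1 + ‖ξ‖) ^ s * ‖locFourier ζ (sderivIter d L v) t ξ‖ ≤ C * localMass m v := by
  induction L generalizing s ζ with
  | nil =>
    have hχ : IsTimeCutoff (-(4 : ℝ) ^ (2 * m))
        fun t => Real.smoothTransition (t - -(4 : ℝ) ^ (2 * m)) :=
      ⟨Real.smoothTransition.contDiff.comp (contDiff_id.sub contDiff_const), fun t ht =>
        Real.smoothTransition.zero_of_nonpos (by linarith)⟩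
    obtain ⟨C, hC0, hC⟩ := exists_norm_locFourier_le hm hδ hκ h s hχ hζ
    refine ⟨C, hC0, fun A lam v hv ξ t ht => ?_⟩
    have h4 : (4 : ℝ) ^ 1 ≤ 4 ^ (2 * m) := pow_le_pow_right₀ (by norm_num) (by lia)
    have h1 := hC A lam v hv ξ t ⟨by linarith [ht.1], ht.2⟩
    rwa [Real.smoothTransition.one_of_one_le (by linarith [ht.1]), abs_one, one_mul] at h1
  | cons i L ih =>
    obtain ⟨C₁, hC₁, h₁⟩ := ih (s + 1) hζ
    obtain ⟨C₂, hC₂, h₂⟩ := ih s (hζ.partialDeriv i)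
    refine ⟨2 * Real.pi * C₁ + C₂, by positivity, fun A lam v hv ξ t ht => ?_⟩
    specialize h₁ A lam v hv ξ t ht
    specialize h₂ A lam v hv ξ t ht
    rw [show sderivIter d (i :: L) v = sderiv d i (sderivIter d L v) from rfl,
      locFourier_sderiv hζ (hv.smooth.sderivIter L)]
    have hκX : 0 ≤ κ lam * (1 + ‖ξ‖) ^ s := mul_nonneg (hκ _ hv.nonneg) (by positivity)
    have h₃ := mul_le_mul_of_nonneg_right (norm_two_pi_I_mul_le ξ i)
      (norm_nonneg (locFourier ζ (sderivIter d L v) t ξ))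
    rw [← norm_smul] at h₃
    have h₄ := mul_le_mul_of_nonneg_left ((norm_sub_le _ (locFourier
      (fun x => fderiv ℝ ζ x (EuclideanSpace.single i 1)) (sderivIter d L v) t ξ)).trans
        (add_le_add_left h₃ _)) hκX
    have h₅ := mul_le_mul_of_nonneg_left h₁ (show 0 ≤ 2 * Real.pi by positivity)
    rw [pow_succ] at h₅
    linarith

lemma exists_norm_sderivIter_le (hm : 1 ≤ m) (hδ : δ ∈ Set.Ioo (0 : ℝ) 1)
    (hκ : ∀ x, 0 ≤ x → 0 ≤ κ x) (h : ∀ s, HasFreqDecay d m l δ κ s) (L : List (Fin d)) :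
    ∃ C, 0 ≤ C ∧ ∀ A lam v, IsLocalSolution d m l δ A lam v → ∀ t ∈ Set.Icc (-1 : ℝ) 0,
      ∀ x ∈ Metric.ball (0 : Esp d) 1,
        κ lam * ‖sderivIter d L v (t, x)‖ ≤ C * localMass m v := by
  let ζ : ContDiffBump (0 : Esp d) := ⟨1, 2, one_pos, one_lt_two⟩
  have hζ : IsCutoff d ζ := by
    refine ⟨ζ.contDiff, ζ.hasCompactSupport, ?_⟩
    rw [ζ.tsupport_eq]
    exact Metric.closedBall_subset_ball (show (2 : ℝ) < 4 by norm_num)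
  obtain ⟨C, hC0, hC⟩ := exists_norm_locFourier_sderivIter_le hm hδ hκ h L (d + 1) hζ
  have hJ0 : 0 ≤ ∫ ξ : Esp d, (1 + ‖ξ‖) ^ (-(d + 1 : ℝ)) :=
    integral_nonneg fun ξ => by positivity
  refine ⟨C * ∫ ξ : Esp d, (1 + ‖ξ‖) ^ (-(d + 1 : ℝ)), by positivity,
    fun A lam v hv t ht x hx => ?_⟩
  have hM0 := localMass_nonneg m v
  rcases (hκ lam hv.nonneg).eq_or_lt with h0 | hpos
  · rw [← h0, zero_mul]
    positivity
  · have hvt : Continuous fun x : Esp d => sderivIter d L v (t, x) :=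
      (hv.smooth.sderivIter L).continuous.comp (by fun_prop)
    have h1 := norm_le_of_fourier_decay (g := fun x => ζ x • sderivIter d L v (t, x))
      (hζ.1.continuous.smul hvt) (hζ.integrable_smul hvt) (B := C * localMass m v / κ lam)
      (fun ξ => by
        rw [le_div_iff₀ hpos]
        refine le_trans (le_of_eq ?_) (hC A lam v hv ξ t ht)
        rw [locFourier]
        ring) x
    have h2 : ζ x = 1 := ζ.one_of_mem_closedBall (Metric.ball_subset_closedBall hx)
    simp only [h2, one_smul] at h1
    refine (mul_le_mul_of_nonneg_left h1 hpos.le).trans (le_of_eq ?_)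
    field_simp

lemma exists_norm_sderiv_add_norm_tderiv_le (hm : 1 ≤ m) (hδ : δ ∈ Set.Ioo (0 : ℝ) 1) :
    ∃ C, 0 < C ∧ ∀ A lam v, IsLocalSolution d m l δ A lam v →
      ∀ z ∈ (Set.Ioo (-(1 : ℝ)) 0) ×ˢ Metric.ball (0 : Esp d) 1,
        (∑ i, ‖sderiv d i v z‖) + ‖tderiv d v z‖ ≤ C * localMass m v := by
  choose C₁ hC₁ h₁ using fun L => exists_norm_sderivIter_le hm hδ (fun _ _ => zero_le_one)
    (hasFreqDecay_one (d := d) (l := l) hm hδ) L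
  obtain ⟨C₂, hC₂, h₂⟩ := exists_norm_sderivIter_le hm hδ (fun _ h => h)
    (hasFreqDecay_id (d := d) (l := l) hm hδ) []
  have hδ0 : 0 < δ := hδ.1
  set D : ℝ := ∑ α ∈ MSetEq d m, ∑ β ∈ MSetEq d m, l * δ⁻¹ * C₁ (mIdxList d (α + β)) with hD
  have hD0 : 0 ≤ D := Finset.sum_nonneg fun α _ => Finset.sum_nonneg fun β _ =>
    mul_nonneg (by positivity) (hC₁ _)
  have hS0 : 0 ≤ ∑ i, C₁ [i] := Finset.sum_nonneg fun i _ => hC₁ _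
  refine ⟨(∑ i, C₁ [i]) + (D + C₂) + 1, by positivity, fun A lam v hv => ?_⟩
  rintro ⟨t, x⟩ ⟨ht, hx⟩
  have hM0 := localMass_nonneg m v
  have hs : ∑ i, ‖sderiv d i v (t, x)‖ ≤ (∑ i, C₁ [i]) * localMass m v := by
    rw [Finset.sum_mul]
    refine Finset.sum_le_sum fun i _ => ?_
    have := h₁ [i] A lam v hv t (Set.Ioo_subset_Icc_self ht) x hx
    rwa [one_mul] at this
  have htd : ‖tderiv d v (t, x)‖ ≤ (D + C₂) * localMass m v := by
    refine le_of_ae_le_of_continuous (U := Set.Ioo (-1 : ℝ) 0)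
      (f := fun t => ‖tderiv d v (t, x)‖) (g := fun _ => (D + C₂) * localMass m v) isOpen_Ioo
      (hv.smooth.tderiv.continuous.comp (by fun_prop)).norm continuous_const ?_ ht
    have h4 : (4 : ℝ) ^ 0 ≤ 4 ^ (2 * m) := pow_le_pow_right₀ (by norm_num) (by lia)
    have hsub : Set.Ioo (-1 : ℝ) 0 ⊆ Set.Ioo (-(4 : ℝ) ^ (2 * m)) 0 :=
      Set.Ioo_subset_Ioo_left (by linarith)
    filter_upwards [ae_restrict_of_ae_restrict_of_subset hsub hv.eqn,
      ae_restrict_mem measurableSet_Ioo] with r hr hrmem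
    have hrI := Set.Ioo_subset_Icc_self hrmem
    have heq := hr x (Metric.ball_subset_ball (by norm_num) hx)
    rw [add_assoc] at heq
    rw [eq_neg_of_add_eq_zero_left heq, norm_neg, add_mul]
    refine (norm_add_le _ _).trans (add_le_add ?_ ?_)
    · rw [norm_smul, norm_pow, norm_neg, norm_one, one_pow, one_mul, hD]
      simp only [Finset.sum_mul]
      refine norm_sum_le_of_le _ fun α hα => norm_sum_le_of_le _ fun β hβ => ?_
      have h3 := h₁ (mIdxList d (α + β)) A lam v hv r hrI x hx
      rw [one_mul] at h3
      refine (norm_mApply_le (by positivity) (hv.bound α hα β hβ r) _).trans ?_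
      rw [mul_assoc (l * δ⁻¹ : ℝ)]
      exact mul_le_mul_of_nonneg_left h3 (by positivity)
    · rw [norm_smul, Real.norm_of_nonneg hv.nonneg]
      exact h₂ A lam v hv r hrI x hx
  linarith

lemma localMass_le {q : ℝ} (hq : 1 < q) {v : Pt d → Fin l → ℂ} (hv : Continuous v) :
    localMass m v ≤
      (∫ _z : Pt d in (Set.Ioo (-(4 : ℝ) ^ (2 * m)) 0) ×ˢ Metric.ball (0 : Esp d) 4, (1 : ℝ)) ^
          (1 - q⁻¹) *
        (∫ z in (Set.Ioo (-(4 : ℝ) ^ (2 * m)) 0) ×ˢ Metric.ball (0 : Esp d) 4, ‖v z‖ ^ q) ^ q⁻¹ := by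
  set Q : Set (Pt d) := (Set.Ioo (-(4 : ℝ) ^ (2 * m)) 0) ×ˢ Metric.ball (0 : Esp d) 4 with hQ
  have hcpt : IsCompact (Set.Icc (-(4 : ℝ) ^ (2 * m)) 0 ×ˢ Metric.closedBall (0 : Esp d) 4) :=
    isCompact_Icc.prod (isCompact_closedBall (0 : Esp d) 4)
  have hsub : Q ⊆ Set.Icc (-(4 : ℝ) ^ (2 * m)) 0 ×ˢ Metric.closedBall (0 : Esp d) 4 :=
    Set.prod_mono Set.Ioo_subset_Icc_self Metric.ball_subset_closedBall
  have hQm : MeasurableSet Q := measurableSet_Ioo.prod Metric.isOpen_ball.measurableSet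
  have : IsFiniteMeasure (volume.restrict Q) :=
    ⟨by rw [Measure.restrict_apply_univ]; exact (measure_mono hsub).trans_lt hcpt.measure_lt_top⟩
  have hpq : q.HolderConjugate (q / (q - 1)) := Real.HolderConjugate.conjExponent hq
  obtain ⟨B, hB⟩ := hcpt.exists_bound_of_continuousOn hv.norm.continuousOn
  have hf : MemLp (fun z => ‖v z‖) (ENNReal.ofReal q) (volume.restrict Q) :=
    MemLp.of_bound hv.norm.aestronglyMeasurable B
      ((ae_restrict_mem hQm).mono fun z hz => hB z (hsub hz))
  have h := integral_mul_le_Lp_mul_Lq_of_nonneg hpq (μ := volume.restrict Q)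
    (ae_of_all _ fun z => norm_nonneg (v z)) (ae_of_all _ fun _ => zero_le_one' ℝ) hf
    (memLp_const 1)
  have hexp : 1 / (q / (q - 1)) = 1 - q⁻¹ := by
    field_simp
  simp only [mul_one, Real.one_rpow, hexp, one_div] at h
  rw [mul_comm]
  exact h

end Pointwise

end SmoothSolutions

/-- **Lemma 4.4 (interior Lipschitz estimate for systems with coefficients measurable in
time).** Let `λ ≥ 0`, `q ∈ (1,∞)`, and let `L` be the `2m`-th order operator whose leading
coefficients `A^{αβ}`, `|α| = |β| = m`, are measurable functions of `t` only satisfying the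
Legendre–Hadamard condition with constant `δ` and `|A^{αβ}| ≤ δ⁻¹`, and whose lower-order
coefficients vanish.  Then for every `u ∈ C^∞_loc(ℝ^{d+1})` satisfying
`u_t + (-1)^m L u + λ u = 0` in `Q₄`:
`Σ_{|α| ≤ 2m} λ^{1-|α|/(2m)} sup_{Q₁} (|D(D^α u)| + |(D^α u)_t|)
  ≤ N Σ_{|α| ≤ 2m} λ^{1-|α|/(2m)} ‖D^α u‖_{L_q(Q₄)}`, `N = N(d, m, ℓ, δ, q)`. -/
theorem statement19 (d m l : ℕ) (hm : 1 ≤ m) (hl : 1 ≤ l) (δ q : ℝ)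
    (hδ : δ ∈ Set.Ioo (0 : ℝ) 1) (hq : 1 < q) :
    ∃ N : ℝ, 0 < N ∧
      ∀ A : (Fin d → ℕ) → (Fin d → ℕ) → ℝ → (Fin l → Fin l → ℂ),
        (∀ α β, Measurable (A α β)) →
        LegendreHadamard d m l δ (fun α β z => A α β z.1) →
        (∀ α ∈ MSetEq d m, ∀ β ∈ MSetEq d m, ∀ t i j, ‖A α β t i j‖ ≤ δ⁻¹) →
        ∀ lam : ℝ, 0 ≤ lam →
        ∀ u : Pt d → (Fin l → ℂ), ContDiff ℝ (⊤ : ℕ∞) u →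
          (∀ᵐ z ∂volume.restrict
              ((Set.Ioo (-(4 : ℝ) ^ (2 * m)) 0) ×ˢ Metric.ball (0 : Esp d) 4),
            tderiv d u z + ((-1 : ℝ) ^ m) •
                (∑ α ∈ MSetEq d m, ∑ β ∈ MSetEq d m,
                  mApply (A α β z.1) (Dpar d (α + β) u z))
              + lam • u z = 0) →
          ∑ α ∈ MSet d (2 * m), lam ^ (1 - (deg α : ℝ) / (2 * m)) *
              (⨆ (z : Pt d) (_ : z ∈ (Set.Ioo (-(1 : ℝ)) 0) ×ˢ Metric.ball (0 : Esp d) 1),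
                ((∑ i, ‖sderiv d i (Dpar d α u) z‖) + ‖tderiv d (Dpar d α u) z‖))
            ≤ N * ∑ α ∈ MSet d (2 * m), lam ^ (1 - (deg α : ℝ) / (2 * m)) *
                (∫ z in (Set.Ioo (-(4 : ℝ) ^ (2 * m)) 0) ×ˢ Metric.ball (0 : Esp d) 4,
                  ‖Dpar d α u z‖ ^ q) ^ q⁻¹ := by
  obtain ⟨C, hC0, hC⟩ := exists_norm_sderiv_add_norm_tderiv_le (d := d) (l := l) hm hδ
  set V : ℝ := ∫ _z : Pt d in (Set.Ioo (-(4 : ℝ) ^ (2 * m)) 0) ×ˢ Metric.ball (0 : Esp d) 4,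
    (1 : ℝ) with hV
  have hV0 : 0 ≤ V := integral_nonneg fun _ => zero_le_one
  refine ⟨C * V ^ (1 - q⁻¹) + 1, by positivity, fun A _ hLH hA lam hlam u hu hsol => ?_⟩
  have hsolution := isLocalSolution_of_ae hLH hA hlam hu hsol
  rw [Finset.mul_sum]
  refine Finset.sum_le_sum fun α _ => ?_
  rw [mul_left_comm]
  refine mul_le_mul_of_nonneg_left ?_ (Real.rpow_nonneg hlam _)
  have hv : IsLocalSolution d m l δ A lam (Dpar d α u) := hsolution.sderivIter (mIdxList d α)
  have hnorm : 0 ≤ (∫ z in (Set.Ioo (-(4 : ℝ) ^ (2 * m)) 0) ×ˢ Metric.ball (0 : Esp d) 4,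
      ‖Dpar d α u z‖ ^ q) ^ q⁻¹ :=
    Real.rpow_nonneg (integral_nonneg fun _ => Real.rpow_nonneg (norm_nonneg _) _) _
  have hN : 0 ≤ (C * V ^ (1 - q⁻¹) + 1) *
      (∫ z in (Set.Ioo (-(4 : ℝ) ^ (2 * m)) 0) ×ˢ Metric.ball (0 : Esp d) 4,
        ‖Dpar d α u z‖ ^ q) ^ q⁻¹ := mul_nonneg (by positivity) hnorm
  refine Real.iSup_le (fun z => Real.iSup_le (fun hz => ?_) hN) hN
  refine (hC A lam _ hv z hz).trans ?_
  have hmass := mul_le_mul_of_nonneg_left (localMass_le (m := m) hq hv.smooth.continuous) hC0.le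
  refine hmass.trans ?_
  rw [add_mul, one_mul, mul_assoc]
  exact le_add_of_nonneg_right hnorm

end
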